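/- arXiv:1011.5162 — 7 statements merged into one kernel-verified Lean document; each statement's English description precedes it below -/
import Mathlib

section
/- Let $\{a_n\}_{n\ge 1}$ be a bounded sequence of real numbers that is convex, i.e. $a_{i+1} \le \tfrac{1}{2}(a_i + a_{i+2})$ for all $i \ge 1$. Then the limit $\lim_{n\to\infty} a_n$ exists and $\sum_{n=1}^{\infty} n\,\Delta^2 a_n = a_1 - \lim_{n\to\infty} a_n$, where $\Delta^2 a_n = a_{n+2} - 2a_{n+1} + a_n$. -/
open Filter

section ConvexSequence

variable {b : ℕ → ℝ}

lemma mul_sub_le_of_monotone_diff (hd : Monotone fun n => b (n + 1) - b n) (m k : ℕ) :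
    k * (b (m + 1) - b m) ≤ b (m + k) - b m := by
  induction k with
  | zero => simp
  | succ k ih =>
    have h : b (m + 1) - b m ≤ b (m + k + 1) - b (m + k) := hd (Nat.le_add_right m k)
    rw [← add_assoc]
    push_cast
    linarith

lemma le_mul_sub_of_monotone_diff (hd : Monotone fun n => b (n + 1) - b n) (m k : ℕ) :
    b (m + k) - b m ≤ k * (b (m + k + 1) - b (m + k)) := by
  induction k with
  | zero => simp
  | succ k ih =>
    have h : b (m + k + 1) - b (m + k) ≤ b (m + k + 1 + 1) - b (m + k + 1) :=
      hd (Nat.le_succ (m + k))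
    have hk : (k : ℝ) * (b (m + k + 1) - b (m + k)) ≤
        k * (b (m + k + 1 + 1) - b (m + k + 1)) := by gcongr
    rw [← add_assoc]
    push_cast
    linarith

lemma antitone_of_monotone_diff_of_bddAbove (hd : Monotone fun n => b (n + 1) - b n)
    (hb : BddAbove (Set.range b)) : Antitone b := by
  refine antitone_nat_of_succ_le fun m => ?_
  by_contra! hm
  obtain ⟨C, hC⟩ := hb
  obtain ⟨k, hk⟩ := exists_nat_gt ((C - b m) / (b (m + 1) - b m))
  rw [div_lt_iff₀ (sub_pos.2 hm)] at hk
  have := mul_sub_le_of_monotone_diff hd m k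
  have := hC (Set.mem_range_self (m + k))
  linarith

lemma tendsto_mul_diff_zero (hd : Monotone fun n => b (n + 1) - b n) (hb : Antitone b)
    {L : ℝ} (hL : Tendsto b atTop (nhds L)) :
    Tendsto (fun n : ℕ => n * (b (n + 1) - b n)) atTop (nhds 0) := by
  have hhalf : Tendsto (fun n : ℕ => n / 2) atTop atTop :=
    Nat.tendsto_div_const_atTop two_ne_zero
  have hlow : Tendsto (fun n : ℕ => 2 * (b n - b (n / 2))) atTop (nhds 0) := by
    simpa using (hL.sub (hL.comp hhalf)).const_mul 2
  refine tendsto_of_tendsto_of_tendsto_of_le_of_le hlow tendsto_const_nhds (fun n => ?_)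
    fun n => mul_nonpos_of_nonneg_of_nonpos n.cast_nonneg (sub_nonpos.2 (hb n.le_succ))
  have h := le_mul_sub_of_monotone_diff hd (n / 2) (n - n / 2)
  rw [Nat.add_sub_cancel' (Nat.div_le_self n 2)] at h
  have hn : (n : ℝ) ≤ 2 * (n - n / 2 : ℕ) := by
    exact_mod_cast (by omega : n ≤ 2 * (n - n / 2))
  have := mul_le_mul_of_nonpos_right hn (sub_nonpos.2 (hb n.le_succ))
  simp only
  linarith

lemma sum_range_succ_mul_second_diff (b : ℕ → ℝ) (n : ℕ) :
    ∑ i ∈ Finset.range n, ((i + 1 : ℕ) : ℝ) * (b (i + 2) - 2 * b (i + 1) + b i) =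
      n * (b (n + 1) - b n) - b n + b 0 := by
  induction n with
  | zero => simp
  | succ n ih =>
    rw [Finset.sum_range_succ, ih]
    push_cast
    ring

end ConvexSequence

/-- If `{a_n}_{n ≥ 1}` is a bounded convex sequence of reals (i.e.
`a (i+1) ≤ (a i + a (i+2)) / 2` for all `i ≥ 1`), then `lim a_n` exists and
`∑_{n=1}^∞ n * Δ² a_n = a 1 - lim a_n`, where `Δ² a_n = a (n+2) - 2 a (n+1) + a n`. -/
theorem convex_bounded_sum_second_difference
    (a : ℕ → ℝ)
    (hbdd : ∃ C : ℝ, ∀ n ≥ 1, |a n| ≤ C)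
    (hconv : ∀ i ≥ 1, a (i + 1) ≤ (a i + a (i + 2)) / 2) :
    ∃ L : ℝ, Tendsto a atTop (nhds L) ∧
      HasSum (fun n : ℕ => ((n + 1 : ℕ) : ℝ) *
        (a ((n + 1) + 2) - 2 * a ((n + 1) + 1) + a (n + 1))) (a 1 - L) := by
  obtain ⟨C, hC⟩ := hbdd
  let b : ℕ → ℝ := fun n => a (n + 1)
  have hd : Monotone fun n => b (n + 1) - b n := monotone_nat_of_le_succ fun n => by
    have : b (n + 1) ≤ (b n + b (n + 1 + 1)) / 2 := hconv (n + 1) (by omega)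
    linarith
  have hanti : Antitone b := antitone_of_monotone_diff_of_bddAbove hd
    ⟨C, Set.forall_mem_range.2 fun n => (abs_le.1 (hC (n + 1) (by omega))).2⟩
  have hL : Tendsto b atTop (nhds (⨅ n, b n)) := tendsto_atTop_ciInf hanti
    ⟨-C, Set.forall_mem_range.2 fun n => (abs_le.1 (hC (n + 1) (by omega))).1⟩
  refine ⟨⨅ n, b n, (tendsto_add_atTop_iff_nat 1).1 hL, ?_⟩
  rw [hasSum_iff_tendsto_nat_of_nonneg]
  · have h := ((tendsto_mul_diff_zero hd hanti hL).sub hL).add_const (b 0)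
    rw [zero_sub, neg_add_eq_sub] at h
    exact h.congr fun n => (sum_range_succ_mul_second_diff b n).symm.trans
      (Finset.sum_congr rfl fun i _ => by simp only [b, add_right_comm i 2 1])
  · intro n
    have := hconv (n + 1) (by omega)
    exact mul_nonneg (Nat.cast_nonneg _) (by linarith)
end

section
/- Let $T$ be a bounded self-adjoint linear operator on a Hilbert space $\mathcal{H}$ with $\|T\| \le 1$. Then for every $X \in \mathcal{H}$, $\sum_{n=1}^{\infty} n\,\|T^{n}X - T^{n+2}X\|^2 = \|TX\|^2 - \lim_{n\to\infty}\|T^{n}X\|^2 \le \|X\|^2$; in particular $\sum_{n=1}^{\infty} \|T^{n}X - T^{n+2}X\|^2 \le \|X\|^2$. -/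
open Filter

/-- The second differences of an antitone convex sequence converging to `L`, weighted by the index,
sum to `a 1 - L`. -/
theorem hasSum_nat_mul_second_difference {a : ℕ → ℝ} {L : ℝ} (ha : Antitone a)
    (hconv : ∀ n, 0 ≤ a n - 2 * a (n + 1) + a (n + 2)) (hL : Tendsto a atTop (nhds L)) :
    HasSum (fun n : ℕ => (n : ℝ) * (a n - 2 * a (n + 1) + a (n + 2))) (a 1 - L) := by
  have hd : Antitone fun n => a n - a (n + 1) :=
    antitone_nat_of_succ_le fun n => by linarith [hconv n]
  have hpartial (N : ℕ) : ∑ n ∈ Finset.range (N + 1),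
      (n : ℝ) * (a n - 2 * a (n + 1) + a (n + 2)) =
        a 1 - a (N + 1) - N * (a (N + 1) - a (N + 2)) := by
    induction N with
    | zero => simp
    | succ N ih =>
      rw [Finset.sum_range_succ, ih]
      push_cast
      ring
  have hblock (M k : ℕ) : (k : ℝ) * (a (M + k) - a (M + k + 1)) ≤ a M - a (M + k) := by
    induction k with
    | zero => simp
    | succ k ih =>
      have h := hd (Nat.le_succ (M + k))
      have hk := mul_le_mul_of_nonneg_left h (Nat.cast_nonneg (α := ℝ) k)
      simp only [Nat.succ_eq_add_one, ← add_assoc] at h hk ⊢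
      push_cast
      linarith
  have hshift (k : ℕ) : Tendsto (fun n => a (n + k)) atTop (nhds L) :=
    hL.comp (tendsto_add_atTop_nat k)
  have hbound : Tendsto (fun N => 2 * (a (N / 2) - a (N + 1))) atTop (nhds 0) := by
    simpa using ((hL.comp (Nat.tendsto_div_const_atTop two_ne_zero)).sub (hshift 1)).const_mul 2
  have hzero : Tendsto (fun N : ℕ => (N : ℝ) * (a (N + 1) - a (N + 2))) atTop (nhds 0) := by
    refine squeeze_zero (fun N => ?_) (fun N => ?_) hbound
    · exact mul_nonneg N.cast_nonneg (sub_nonneg.2 (ha (Nat.le_succ _)))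
    · have h := hblock (N / 2) (N + 1 - N / 2)
      rw [show N / 2 + (N + 1 - N / 2) = N + 1 by omega] at h
      have hN : (N : ℝ) ≤ 2 * ((N + 1 - N / 2 : ℕ) : ℝ) := by
        exact_mod_cast (by omega : N ≤ 2 * (N + 1 - N / 2))
      have hmul := mul_le_mul_of_nonneg_right hN (sub_nonneg.2 (ha (Nat.le_succ (N + 1))))
      simp only [Nat.succ_eq_add_one, add_assoc, Nat.reduceAdd] at h hmul
      linarith
  rw [hasSum_iff_tendsto_nat_of_nonneg fun n => mul_nonneg n.cast_nonneg (hconv n),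
    ← tendsto_add_atTop_iff_nat 1]
  simp_rw [hpartial]
  simpa using (tendsto_const_nhds.sub (hshift 1)).sub hzero

theorem IsSelfAdjoint.norm_sq_sub_apply_apply {𝕜 : Type*} [RCLike 𝕜] {H : Type*}
    [NormedAddCommGroup H] [InnerProductSpace 𝕜 H] [CompleteSpace H] {T : H →L[𝕜] H}
    (hT : IsSelfAdjoint T) (x : H) :
    ‖x - T (T x)‖ ^ 2 = ‖x‖ ^ 2 - 2 * ‖T x‖ ^ 2 + ‖T (T x)‖ ^ 2 := by
  rw [@norm_sub_sq 𝕜, ← hT.isSymmetric.apply_clm x (T x), inner_self_eq_norm_sq]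

/-- For a self-adjoint contraction `T` on a Hilbert space and any `X`,
`∑_{n≥1} n ‖T^n X - T^{n+2} X‖² = ‖T X‖² - lim_n ‖T^n X‖² ≤ ‖X‖²`; in particular
`∑_{n≥1} ‖T^n X - T^{n+2} X‖² ≤ ‖X‖²`. -/
theorem sum_norm_sq_diff_pow_le
    {𝕜 : Type*} [RCLike 𝕜] {H : Type*} [NormedAddCommGroup H]
    [InnerProductSpace 𝕜 H] [CompleteSpace H]
    (T : H →L[𝕜] H) (hT : IsSelfAdjoint T) (hnorm : ‖T‖ ≤ 1) (X : H) :
    ∃ L : ℝ, Tendsto (fun n : ℕ => ‖(T ^ n) X‖ ^ 2) atTop (nhds L) ∧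
      HasSum (fun n : ℕ => (n : ℝ) * ‖(T ^ n) X - (T ^ (n + 2)) X‖ ^ 2) (‖T X‖ ^ 2 - L) ∧
      ‖T X‖ ^ 2 - L ≤ ‖X‖ ^ 2 ∧
      ∑' n : ℕ, ‖(T ^ (n + 1)) X - (T ^ (n + 3)) X‖ ^ 2 ≤ ‖X‖ ^ 2 := by
  have hsucc (n : ℕ) : (T ^ (n + 1)) X = T ((T ^ n) X) := by
    rw [pow_succ', mul_apply_eq_comp]
  have hanti : Antitone fun n : ℕ => ‖(T ^ n) X‖ ^ 2 := antitone_nat_of_succ_le fun n => by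
    rw [hsucc]
    gcongr
    exact T.le_of_opNorm_le_of_le hnorm le_rfl |>.trans_eq (one_mul _)
  have hdiff (n : ℕ) : ‖(T ^ n) X - (T ^ (n + 2)) X‖ ^ 2 =
      ‖(T ^ n) X‖ ^ 2 - 2 * ‖(T ^ (n + 1)) X‖ ^ 2 + ‖(T ^ (n + 2)) X‖ ^ 2 := by
    rw [hsucc (n + 1), hsucc n, hT.norm_sq_sub_apply_apply]
  have hL := tendsto_atTop_ciInf hanti ⟨0, by rintro _ ⟨n, rfl⟩; positivity⟩
  set L := ⨅ n : ℕ, ‖(T ^ n) X‖ ^ 2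
  have hL0 : 0 ≤ L := Real.iInf_nonneg fun n => by positivity
  have hsum : HasSum (fun n : ℕ => (n : ℝ) * ‖(T ^ n) X - (T ^ (n + 2)) X‖ ^ 2)
      (‖T X‖ ^ 2 - L) := by
    simpa only [← hdiff, pow_one] using
      hasSum_nat_mul_second_difference hanti (fun n => (hdiff n).symm ▸ sq_nonneg _) hL
  have hle : ‖T X‖ ^ 2 - L ≤ ‖X‖ ^ 2 := by
    have h := hanti zero_le_one
    simp only [pow_one, pow_zero, one_apply_eq_self] at h
    linarith
  refine ⟨L, hL, hsum, hle, ?_⟩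
  have hsum' := (hasSum_nat_add_iff' 1).2 hsum
  simp only [Finset.range_one, Finset.sum_singleton, Nat.cast_zero, zero_mul, sub_zero] at hsum'
  have hterm (n : ℕ) : ‖(T ^ (n + 1)) X - (T ^ (n + 3)) X‖ ^ 2 ≤
      ((n + 1 : ℕ) : ℝ) * ‖(T ^ (n + 1)) X - (T ^ (n + 1 + 2)) X‖ ^ 2 :=
    le_mul_of_one_le_left (sq_nonneg _) (by simp)
  have hsummable := hsum'.summable.of_nonneg_of_le (fun n => sq_nonneg _) hterm
  exact (hasSum_le hterm hsummable.hasSum hsum').trans hle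
end

section
/- Let $(\Omega, \mathcal{F}, \mathbb{P})$ be a probability space and let $T$ be a bounded self-adjoint linear operator on $L_2(\Omega, \mathcal{F}, \mathbb{P})$ with $\|T\| \le 1$. Then for every $X \in L_2$, the series $\sum_{n=1}^{\infty} n\,|T^{2n}X(\omega) - T^{2(n+1)}X(\omega)|^2$ is finite for almost every $\omega \in \Omega$; in fact its integral over $\Omega$ is at most $\tfrac{1}{2}\|X\|_2^2$. -/
open Filter MeasureTheory
open scoped ENNReal NNReal

section InnerProductSpace

variable {E : Type*} [NormedAddCommGroup E] [InnerProductSpace ℝ E]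

/-- Applying a symmetric operator `T` to `x` makes the second difference of `n ↦ ‖T ^ n x‖ ^ 2`
at `0` equal to `‖x - T (T x)‖ ^ 2`. -/
theorem LinearMap.IsSymmetric.norm_sub_apply_apply_sq {T : E →ₗ[ℝ] E} (hT : T.IsSymmetric)
    (x : E) : ‖x - T (T x)‖ ^ 2 = ‖x‖ ^ 2 - 2 * ‖T x‖ ^ 2 + ‖T (T x)‖ ^ 2 := by
  rw [norm_sub_sq_real, ← hT x (T x), real_inner_self_eq_norm_sq]

variable [CompleteSpace E] {T : E →L[ℝ] E}

theorem IsSelfAdjoint.sum_succ_mul_norm_pow_sub_sq (hT : IsSelfAdjoint T) (x : E) (N : ℕ) :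
    ∑ j ∈ Finset.range N, ((j : ℝ) + 1) * ‖(T ^ j) x - (T ^ (j + 2)) x‖ ^ 2
      + N * (‖(T ^ N) x‖ ^ 2 - ‖(T ^ (N + 1)) x‖ ^ 2) + ‖(T ^ N) x‖ ^ 2 = ‖x‖ ^ 2 := by
  induction N with
  | zero => simp
  | succ N ih =>
    have h := hT.isSymmetric.norm_sub_apply_apply_sq ((T ^ N) x)
    simp only [ContinuousLinearMap.coe_coe, ← mul_apply_eq_comp, ← pow_succ'] at h
    rw [Finset.sum_range_succ, h, ← ih]
    push_cast
    ring

theorem IsSelfAdjoint.sum_mul_norm_pow_sub_sq_le (hT : IsSelfAdjoint T) (hnorm : ‖T‖ ≤ 1)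
    (x : E) (N : ℕ) :
    ∑ j ∈ Finset.range N, (j : ℝ) * ‖(T ^ j) x - (T ^ (j + 2)) x‖ ^ 2 ≤ ‖x‖ ^ 2 := by
  have hanti : ‖(T ^ (N + 1)) x‖ ^ 2 ≤ ‖(T ^ N) x‖ ^ 2 := by
    rw [pow_succ' T, mul_apply_eq_comp]
    gcongr
    exact T.le_of_opNorm_le_of_le hnorm le_rfl |>.trans_eq (one_mul _)
  have hle : ∑ j ∈ Finset.range N, (j : ℝ) * ‖(T ^ j) x - (T ^ (j + 2)) x‖ ^ 2 ≤
      ∑ j ∈ Finset.range N, ((j : ℝ) + 1) * ‖(T ^ j) x - (T ^ (j + 2)) x‖ ^ 2 := by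
    gcongr
    linarith
  have hnonneg : 0 ≤ (N : ℝ) * (‖(T ^ N) x‖ ^ 2 - ‖(T ^ (N + 1)) x‖ ^ 2) :=
    mul_nonneg N.cast_nonneg (sub_nonneg.2 hanti)
  linarith [hT.sum_succ_mul_norm_pow_sub_sq x N, sq_nonneg ‖(T ^ N) x‖]

end InnerProductSpace

theorem two_mul_sum_range_mul_even_le {c : ℕ → ℝ} (hc : ∀ j, 0 ≤ c j) (N : ℕ) :
    2 * ∑ n ∈ Finset.range N, (n : ℝ) * c (2 * n) ≤
      ∑ j ∈ Finset.range (2 * N), (j : ℝ) * c j := by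
  induction N with
  | zero => simp
  | succ N ih =>
    rw [Finset.sum_range_succ, show 2 * (N + 1) = 2 * N + 1 + 1 by ring, Finset.sum_range_succ,
      Finset.sum_range_succ]
    have h : 0 ≤ ((2 * N + 1 : ℕ) : ℝ) * c (2 * N + 1) := mul_nonneg (Nat.cast_nonneg _) (hc _)
    have h' : ((2 * N : ℕ) : ℝ) = 2 * N := by push_cast; rfl
    rw [h']
    linarith

theorem IsSelfAdjoint.sum_mul_norm_even_pow_sub_sq_le {E : Type*} [NormedAddCommGroup E]
    [InnerProductSpace ℝ E] [CompleteSpace E] {T : E →L[ℝ] E} (hT : IsSelfAdjoint T)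
    (hnorm : ‖T‖ ≤ 1) (x : E) (N : ℕ) :
    ∑ n ∈ Finset.range N, (n : ℝ) * ‖(T ^ (2 * n)) x - (T ^ (2 * (n + 1))) x‖ ^ 2 ≤
      ‖x‖ ^ 2 / 2 := by
  have h := two_mul_sum_range_mul_even_le
    (c := fun j ↦ ‖(T ^ j) x - (T ^ (j + 2)) x‖ ^ 2) (fun _ ↦ sq_nonneg _) N
  simp only [mul_add, mul_one] at h ⊢
  linarith [hT.sum_mul_norm_pow_sub_sq_le hnorm x (2 * N)]

theorem MeasureTheory.Lp.lintegral_nnnorm_sub_sq {α F : Type*} [MeasurableSpace α]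
    {μ : Measure α} [NormedAddCommGroup F] (f g : Lp F 2 μ) :
    ∫⁻ a, (‖f a - g a‖₊ : ℝ≥0∞) ^ 2 ∂μ = ENNReal.ofReal (‖f - g‖ ^ 2) := by
  have h := eLpNorm_nnreal_pow_eq_lintegral (f := ⇑(f - g)) (μ := μ) (p := 2) two_ne_zero
  simp only [ENNReal.coe_ofNat, NNReal.coe_ofNat, ENNReal.rpow_ofNat] at h
  rw [ENNReal.ofReal_pow (norm_nonneg _), ofReal_norm, Lp.enorm_def, h]
  refine lintegral_congr_ae ?_
  filter_upwards [Lp.coeFn_sub f g] with a ha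
  rw [ha, Pi.sub_apply, enorm_eq_nnnorm]

/-- For a self-adjoint contraction `T` on `L²(Ω, F, P)` and `X ∈ L²`, the series
`∑_{n≥1} n |T^{2n}X(ω) - T^{2(n+1)}X(ω)|²` is finite a.e., and its integral is at most
`‖X‖² / 2`. -/
theorem ae_summable_weighted_even_iterates
    {Ω : Type*} [MeasurableSpace Ω] {μ : Measure Ω} [IsProbabilityMeasure μ]
    (T : Lp ℝ 2 μ →L[ℝ] Lp ℝ 2 μ) (hT : IsSelfAdjoint T) (hnorm : ‖T‖ ≤ 1)
    (X : Lp ℝ 2 μ) :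
    (∀ᵐ ω ∂μ, (∑' n : ℕ,
        (n : ℝ≥0∞) * (‖(T ^ (2 * n)) X ω - (T ^ (2 * (n + 1))) X ω‖₊ : ℝ≥0∞) ^ 2) < ⊤) ∧
      ∫⁻ ω, (∑' n : ℕ,
          (n : ℝ≥0∞) * (‖(T ^ (2 * n)) X ω - (T ^ (2 * (n + 1))) X ω‖₊ : ℝ≥0∞) ^ 2) ∂μ ≤
        ENNReal.ofReal (‖X‖ ^ 2 / 2) := by
  have hmeas (n : ℕ) : AEMeasurable (fun ω ↦ (n : ℝ≥0∞) *
      (‖(T ^ (2 * n)) X ω - (T ^ (2 * (n + 1))) X ω‖₊ : ℝ≥0∞) ^ 2) μ :=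
    (((Lp.aestronglyMeasurable ((T ^ (2 * n)) X)).sub
      (Lp.aestronglyMeasurable ((T ^ (2 * (n + 1))) X))).enorm.pow_const 2).const_mul _
  have hint : ∫⁻ ω, (∑' n : ℕ,
      (n : ℝ≥0∞) * (‖(T ^ (2 * n)) X ω - (T ^ (2 * (n + 1))) X ω‖₊ : ℝ≥0∞) ^ 2) ∂μ ≤
        ENNReal.ofReal (‖X‖ ^ 2 / 2) := by
    rw [lintegral_tsum hmeas]
    refine ENNReal.tsum_le_of_sum_range_le fun N ↦ ?_
    calc
      _ = ∑ n ∈ Finset.range N, ENNReal.ofReal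
          ((n : ℝ) * ‖(T ^ (2 * n)) X - (T ^ (2 * (n + 1))) X‖ ^ 2) := by
        refine Finset.sum_congr rfl fun n _ ↦ ?_
        rw [lintegral_const_mul' _ _ (ENNReal.natCast_ne_top n), Lp.lintegral_nnnorm_sub_sq,
          ENNReal.ofReal_mul n.cast_nonneg, ENNReal.ofReal_natCast]
      _ ≤ _ := by
        rw [← ENNReal.ofReal_sum_of_nonneg fun _ _ ↦ by positivity]
        exact ENNReal.ofReal_le_ofReal (hT.sum_mul_norm_even_pow_sub_sq_le hnorm X N)
  exact ⟨ae_lt_top' (AEMeasurable.tsum hmeas) (hint.trans_lt ENNReal.ofReal_lt_top).ne, hint⟩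
end

section
/- Let $(\Omega, \mathcal{F}, \mathbb{P})$ be a probability space and let $T$ be a bounded self-adjoint linear operator on $L_2 = L_2(\Omega, \mathcal{F}, \mathbb{P})$ satisfying $\|TX\|_1 \le \|X\|_1$ and $\|TX\|_{\infty} \le \|X\|_{\infty}$ for all $X \in L_2$. Then $\|T\| \le 1$ on $L_2$, and for every $X \in L_2$, $T^{2n}X \to QX$ almost surely as $n \to \infty$, where $Q$ is the orthogonal projection arising as the strong $L_2$-limit of $T^{2n}$. -/
open Filter MeasureTheory
open scoped ENNReal NNReal

section HilbertSpace

variable {H : Type*} [NormedAddCommGroup H] [InnerProductSpace ℝ H] {T : H →L[ℝ] H}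

open scoped RealInnerProductSpace

lemma norm_pow_apply_antitone (hT1 : ‖T‖ ≤ 1) (x : H) : Antitone fun n : ℕ => ‖(T ^ n) x‖ := by
  refine antitone_nat_of_succ_le fun n => ?_
  rw [pow_succ', mul_apply_eq_comp]
  simpa using T.le_of_opNorm_le hT1 ((T ^ n) x)

variable [CompleteSpace H]

lemma IsSelfAdjoint.inner_pow_apply (hT : IsSelfAdjoint T) (a b : ℕ) (x : H) :
    ⟪(T ^ a) x, (T ^ b) x⟫ = ⟪(T ^ (a + b)) x, x⟫ := by
  have h : ⟪(T ^ a) ((T ^ b) x), x⟫ = ⟪(T ^ b) x, (T ^ a) x⟫ := (hT.pow a).isSymmetric _ _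
  rw [pow_add, mul_apply_eq_comp, h, real_inner_comm]

lemma IsSelfAdjoint.norm_apply_le_of_bounded_orbit (hT : IsSelfAdjoint T) {x : H} {C : ℝ}
    (hC : ∀ n : ℕ, ‖(T ^ n) x‖ ≤ C) : ‖T x‖ ≤ ‖x‖ := by
  by_contra! hlt
  have hx : 0 < ‖x‖ := by
    rcases eq_or_ne x 0 with rfl | h
    · simp at hlt
    · exact norm_pos_iff.2 h
  set r := ‖T x‖ / ‖x‖ with hr
  have hr1 : 1 < r := (one_lt_div hx).2 hlt
  have hconv (n : ℕ) : ‖(T ^ (n + 1)) x‖ ^ 2 ≤ ‖(T ^ (n + 2)) x‖ * ‖(T ^ n) x‖ := by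
    rw [← real_inner_self_eq_norm_sq, hT.inner_pow_apply,
      show n + 1 + (n + 1) = n + 2 + n by ring, ← hT.inner_pow_apply]
    exact real_inner_le_norm _ _
  have hgrow (n : ℕ) : 0 < ‖(T ^ n) x‖ ∧ r * ‖(T ^ n) x‖ ≤ ‖(T ^ (n + 1)) x‖ := by
    induction n with
    | zero => simpa [hr, hx.ne'] using hx
    | succ n ih =>
      obtain ⟨h0, h1⟩ := ih
      have hpos : 0 < ‖(T ^ (n + 1)) x‖ := lt_of_lt_of_le (by positivity) h1
      refine ⟨hpos, ?_⟩
      have h2 := hconv n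
      refine le_of_mul_le_mul_right (le_trans ?_ h2) h0
      nlinarith
  have hpow (n : ℕ) : r ^ n * ‖x‖ ≤ ‖(T ^ n) x‖ := by
    induction n with
    | zero => simp
    | succ n ih =>
      refine le_trans ?_ (hgrow n).2
      rw [pow_succ', mul_assoc]
      gcongr
  obtain ⟨n, hn⟩ := pow_unbounded_of_one_lt (C / ‖x‖) hr1
  rw [div_lt_iff₀ hx] at hn
  linarith [hpow n, hC n]

lemma IsSelfAdjoint.cauchySeq_sq_pow_apply (hT : IsSelfAdjoint T) (hT1 : ‖T‖ ≤ 1) (x : H) :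
    CauchySeq fun n : ℕ => ((T ^ 2) ^ n) x := by
  have hanti : Antitone fun n : ℕ => ‖(T ^ n) x‖ ^ 2 := fun m n h =>
    pow_le_pow_left₀ (norm_nonneg _) (norm_pow_apply_antitone hT1 x h) 2
  have hcau : CauchySeq fun n : ℕ => ‖(T ^ n) x‖ ^ 2 :=
    (tendsto_atTop_ciInf hanti ⟨0, by rintro _ ⟨n, rfl⟩; positivity⟩).cauchySeq
  rw [Metric.cauchySeq_iff'] at hcau ⊢
  intro ε hε
  obtain ⟨N, hN⟩ := hcau (ε ^ 2) (by positivity)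
  refine ⟨N, fun n hn => ?_⟩
  have hsq : ‖((T ^ 2) ^ n) x - ((T ^ 2) ^ N) x‖ ^ 2 < ε ^ 2 := by
    rw [norm_sub_sq_real, ← pow_mul, ← pow_mul, hT.inner_pow_apply,
      show 2 * n + 2 * N = (n + N) + (n + N) by ring, ← hT.inner_pow_apply,
      real_inner_self_eq_norm_sq]
    have h1 := hanti (show N ≤ 2 * N by omega)
    have h2 := hanti (show n + N ≤ 2 * n by omega)
    have h3 := hN (n + N) (by omega)
    rw [Real.dist_eq, abs_lt] at h3
    dsimp only at h1 h2
    linarith [h3.1]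
  rw [dist_eq_norm]
  exact lt_of_pow_lt_pow_left₀ 2 hε.le hsq

lemma IsSelfAdjoint.exists_tendsto_sq_pow_apply (hT : IsSelfAdjoint T) (hT1 : ‖T‖ ≤ 1) :
    ∃ Q : H →L[ℝ] H, IsSelfAdjoint Q ∧ Q.comp Q = Q ∧ (∀ x, (T ^ 2) (Q x) = Q x) ∧
      ∀ x, Tendsto (fun n : ℕ => ((T ^ 2) ^ n) x) atTop (nhds (Q x)) := by
  choose q hq using fun x => cauchySeq_tendsto_of_complete (hT.cauchySeq_sq_pow_apply hT1 x)
  let Q : H →L[ℝ] H := continuousLinearMapOfTendsto (fun n : ℕ => (T ^ 2) ^ n)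
    (tendsto_pi_nhds.2 hq)
  have hQ (x : H) : Tendsto (fun n : ℕ => ((T ^ 2) ^ n) x) atTop (nhds (Q x)) := hq x
  have hfix (x : H) : (T ^ 2) (Q x) = Q x := by
    refine tendsto_nhds_unique (((T ^ 2).continuous.tendsto _).comp (hQ x)) ?_
    simpa [Function.comp_def, pow_succ'] using (tendsto_add_atTop_iff_nat 1).2 (hQ x)
  have hfixn (x : H) (n : ℕ) : ((T ^ 2) ^ n) (Q x) = Q x := by
    induction n with
    | zero => simp
    | succ n ih => rw [pow_succ, mul_apply_eq_comp, hfix, ih]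
  refine ⟨Q, ?_, ?_, hfix, hQ⟩
  · rw [ContinuousLinearMap.isSelfAdjoint_iff_isSymmetric]
    intro x y
    refine tendsto_nhds_unique ((hQ x).inner tendsto_const_nhds) ?_
    refine (tendsto_const_nhds.inner (hQ y)).congr fun n => ?_
    exact (((hT.pow 2).pow n).isSymmetric x y).symm
  · ext x
    exact tendsto_nhds_unique (hQ (Q x)) (by simp [hfixn])

lemma IsSelfAdjoint.sum_range_mul_norm_sq_le (hT : IsSelfAdjoint T) (hT1 : ‖T‖ ≤ 1) (x : H)
    (n : ℕ) :
    ∑ k ∈ Finset.range n,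
      ((k : ℝ) + 1) * ‖((T ^ 2) ^ k) x - ((T ^ 2) ^ (k + 1)) x‖ ^ 2 ≤ ‖x‖ ^ 2 := by
  have hterm (k : ℕ) : ‖((T ^ 2) ^ k) x - ((T ^ 2) ^ (k + 1)) x‖ ^ 2 ≤
      ‖(T ^ k) x‖ ^ 2 - 2 * ‖(T ^ (k + 1)) x‖ ^ 2 + ‖(T ^ (k + 2)) x‖ ^ 2 := by
    have h1 : ((T ^ 2) ^ k) x - ((T ^ 2) ^ (k + 1)) x = (T ^ k) ((T ^ k) x - (T ^ (k + 2)) x) := by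
      rw [map_sub, ← mul_apply_eq_comp, ← mul_apply_eq_comp, ← pow_add,
        ← pow_add, ← pow_mul, ← pow_mul]
      ring_nf
    have h2 : ‖(T ^ k) ((T ^ k) x - (T ^ (k + 2)) x)‖ ≤ ‖(T ^ k) x - (T ^ (k + 2)) x‖ := by
      simpa using norm_pow_apply_antitone hT1 ((T ^ k) x - (T ^ (k + 2)) x) (Nat.zero_le k)
    rw [h1]
    refine (pow_le_pow_left₀ (norm_nonneg _) h2 2).trans_eq ?_
    rw [norm_sub_sq_real, hT.inner_pow_apply, show k + (k + 2) = (k + 1) + (k + 1) by ring,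
      ← hT.inner_pow_apply, real_inner_self_eq_norm_sq]
  have hsum (n : ℕ) : ∑ k ∈ Finset.range n, ((k : ℝ) + 1) *
      (‖(T ^ k) x‖ ^ 2 - 2 * ‖(T ^ (k + 1)) x‖ ^ 2 + ‖(T ^ (k + 2)) x‖ ^ 2) =
      ‖x‖ ^ 2 - ‖(T ^ n) x‖ ^ 2 - n * (‖(T ^ n) x‖ ^ 2 - ‖(T ^ (n + 1)) x‖ ^ 2) := by
    induction n with
    | zero => simp
    | succ n ih => rw [Finset.sum_range_succ, ih]; push_cast; ring
  refine (Finset.sum_le_sum fun k _ => mul_le_mul_of_nonneg_left (hterm k) (by positivity)).trans ?_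
  rw [hsum]
  have := pow_le_pow_left₀ (norm_nonneg _) (norm_pow_apply_antitone hT1 x (Nat.le_succ n)) 2
  have h3 : 0 ≤ (n : ℝ) * (‖(T ^ n) x‖ ^ 2 - ‖(T ^ (n + 1)) x‖ ^ 2) :=
    mul_nonneg (by positivity) (sub_nonneg.2 this)
  nlinarith [sq_nonneg ‖(T ^ n) x‖]

end HilbertSpace

/-- If `∑ (k + 1) (a k - a (k + 1))²` converges, the sequence `a` is asymptotic to its averages. -/
lemma tendsto_average_sub_of_summable {a : ℕ → ℝ}
    (ha : Summable fun k : ℕ => ((k : ℝ) + 1) * (a k - a (k + 1)) ^ 2) :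
    Tendsto (fun n : ℕ => (n : ℝ)⁻¹ * ∑ k ∈ Finset.range n, a k - a n) atTop (nhds 0) := by
  set b : ℕ → ℝ := fun k => ((k : ℝ) + 1) * (a k - a (k + 1)) ^ 2
  have hid (n : ℕ) : ∑ k ∈ Finset.range n, a k - n * a n =
      ∑ k ∈ Finset.range n, ((k : ℝ) + 1) * (a k - a (k + 1)) := by
    induction n with
    | zero => simp
    | succ n ih =>
      rw [Finset.sum_range_succ, Finset.sum_range_succ, ← ih]; push_cast; ring
  have hK : Tendsto (fun n : ℕ => (n : ℝ)⁻¹ * ∑ k ∈ Finset.range n, ((k : ℝ) + 1) * b k)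
      atTop (nhds 0) := by
    have hdom := tendsto_tsum_of_dominated_convergence (𝓕 := atTop)
      (f := fun (n k : ℕ) => if k ∈ Finset.range n then (n : ℝ)⁻¹ * (((k : ℝ) + 1) * b k) else 0)
      (g := fun _ => 0) ha ?_ ?_
    · simp only [tsum_zero] at hdom
      refine hdom.congr fun n => ?_
      rw [tsum_eq_sum (s := Finset.range n) (fun k hk => if_neg hk), Finset.mul_sum]
      exact Finset.sum_congr rfl fun k hk => if_pos hk
    · intro k
      have h0 : Tendsto (fun n : ℕ => (n : ℝ)⁻¹ * (((k : ℝ) + 1) * b k)) atTop (nhds 0) := by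
        simpa using (tendsto_inv_atTop_nhds_zero_nat (𝕜 := ℝ)).mul_const (((k : ℝ) + 1) * b k)
      refine h0.congr' ?_
      filter_upwards [eventually_gt_atTop k] with n hn
      rw [if_pos (Finset.mem_range.2 hn)]
    · refine Eventually.of_forall fun n k => ?_
      have hb : 0 ≤ b k := by positivity
      split_ifs with h
      · have hkn : (k : ℝ) + 1 ≤ n := by exact_mod_cast Finset.mem_range.1 h
        have hn : (0 : ℝ) < n := lt_of_lt_of_le (by positivity) hkn
        rw [Real.norm_of_nonneg (by positivity), ← mul_assoc]
        refine mul_le_of_le_one_left hb ?_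
        rw [inv_mul_le_iff₀ hn]; simpa using hkn
      · simpa using hb
  rw [Metric.tendsto_atTop]
  intro ε hε
  have hev := (hK.eventually (gt_mem_nhds (show (0 : ℝ) < ε ^ 2 / 4 by positivity))).and
    (eventually_gt_atTop 0)
  obtain ⟨N, hN⟩ := eventually_atTop.1 hev
  refine ⟨N, fun n hn => ?_⟩
  obtain ⟨h1, h2⟩ := hN n hn
  have hn0 : (0 : ℝ) < n := by exact_mod_cast h2
  have hcs : (∑ k ∈ Finset.range n, ((k : ℝ) + 1) * (a k - a (k + 1))) ^ 2 ≤
      n * ∑ k ∈ Finset.range n, ((k : ℝ) + 1) * b k := by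
    refine (sq_sum_le_card_mul_sum_sq (s := Finset.range n)
      (f := fun k => ((k : ℝ) + 1) * (a k - a (k + 1)))).trans_eq ?_
    rw [Finset.card_range]
    congr 1
    exact Finset.sum_congr rfl fun k _ => by simp only [b]; ring
  have hval : (n : ℝ)⁻¹ * ∑ k ∈ Finset.range n, a k - a n =
      (n : ℝ)⁻¹ * ∑ k ∈ Finset.range n, ((k : ℝ) + 1) * (a k - a (k + 1)) := by
    rw [← hid]; field_simp
  rw [dist_zero_right, Real.norm_eq_abs, hval]
  refine abs_lt_of_sq_lt_sq ?_ hε.le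
  rw [mul_pow]
  calc (n : ℝ)⁻¹ ^ 2 * (∑ k ∈ Finset.range n, ((k : ℝ) + 1) * (a k - a (k + 1))) ^ 2
      ≤ (n : ℝ)⁻¹ ^ 2 * (n * ∑ k ∈ Finset.range n, ((k : ℝ) + 1) * b k) := by gcongr
    _ = (n : ℝ)⁻¹ * ∑ k ∈ Finset.range n, ((k : ℝ) + 1) * b k := by field_simp
    _ < ε ^ 2 := by linarith [sq_nonneg ε]

section FillingScheme

variable {Ω : Type*} [MeasurableSpace Ω] {μ : Measure Ω}

/-- The sequences of the filling scheme for `S`: at time `n` the mass `h n` arrives, the part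
`b n` of it fits into the remaining room `r n`, and the excess `h n - b n` is moved by `S`. -/
lemma exists_filling_scheme [IsFiniteMeasure μ] (S : Lp ℝ 2 μ →L[ℝ] Lp ℝ 2 μ) (f : Lp ℝ 2 μ)
    (c : ℝ) :
    ∃ h r b : ℕ → Lp ℝ 2 μ, h 0 = f ∧ (∀ n, h (n + 1) = S (h n - b n)) ∧
      ∀ᵐ x ∂μ, r 0 x = c ∧ ∀ n, b n x = max (min (h n x) (r n x)) (-r n x) ∧
        r (n + 1) x = r n x - |b n x| ∧ (h n - b n : Lp ℝ 2 μ) x = h n x - b n x := by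
  let clamp : Lp ℝ 2 μ × Lp ℝ 2 μ → Lp ℝ 2 μ := fun p => (p.1 ⊓ p.2) ⊔ (-p.2)
  let p : ℕ → Lp ℝ 2 μ × Lp ℝ 2 μ := fun n =>
    Nat.rec (f, Lp.const 2 μ c) (fun _ q => (S (q.1 - clamp q), q.2 - |clamp q|)) n
  refine ⟨fun n => (p n).1, fun n => (p n).2, fun n => clamp (p n), rfl, fun _ => rfl, ?_⟩
  refine (Lp.coeFn_const (p := 2) (μ := μ) (c := c)).and (ae_all_iff.2 fun n => ?_)
  filter_upwards [Lp.coeFn_sup ((p n).1 ⊓ (p n).2) (-(p n).2), Lp.coeFn_inf (p n).1 (p n).2,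
    Lp.coeFn_neg (p n).2, Lp.coeFn_sub (p n).2 |clamp (p n)|, Lp.coeFn_abs (clamp (p n)),
    Lp.coeFn_sub (p n).1 (clamp (p n))] with x h1 h2 h3 h4 h5 h6
  refine ⟨?_, ?_, h6⟩
  · rw [h1, Pi.sup_apply, h2, h3]; rfl
  · rw [← h5]; exact h4

lemma filling_room_nonneg {h r b : ℕ → ℝ} {c : ℝ} (hc : 0 ≤ c) (h0 : r 0 = c)
    (hb : ∀ n, b n = max (min (h n) (r n)) (-r n)) (hr : ∀ n, r (n + 1) = r n - |b n|) (n : ℕ) :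
    0 ≤ r n := by
  induction n with
  | zero => rwa [h0]
  | succ n ih => rw [hr, hb]; grind

lemma filling_room_antitone {r b : ℕ → ℝ} (hr : ∀ n, r (n + 1) = r n - |b n|) : Antitone r :=
  antitone_nat_of_succ_le fun n => by rw [hr]; linarith [abs_nonneg (b n)]

lemma filling_abs_split {h r b : ℕ → ℝ} {n : ℕ} (hrn : 0 ≤ r n)
    (hb : b n = max (min (h n) (r n)) (-r n)) : |h n| = |b n| + |h n - b n| := by
  grind

lemma filling_abs_sum_le {r b : ℕ → ℝ} {c : ℝ} (h0 : r 0 = c) (hr0 : ∀ n, 0 ≤ r n)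
    (hr : ∀ n, r (n + 1) = r n - |b n|) (n : ℕ) : |∑ k ∈ Finset.range n, b k| ≤ c := by
  have hsum : ∑ k ∈ Finset.range n, |b k| = c - r n := by
    induction n with
    | zero => simp [h0]
    | succ n ih => rw [Finset.sum_range_succ, ih, hr]; ring
  linarith [Finset.abs_sum_le_sum_abs b (Finset.range n), hr0 n]

lemma filling_excess_eq_zero {h r b : ℕ → ℝ} (hr0 : ∀ n, 0 ≤ r n)
    (hb : ∀ n, b n = max (min (h n) (r n)) (-r n)) (hr : ∀ n, r (n + 1) = r n - |b n|) {n k : ℕ}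
    (hn : 0 < r n) (hk : k < n) : h k - b k = 0 := by
  have h1 : 0 < r (k + 1) := hn.trans_le (filling_room_antitone hr hk)
  have h2 := hr k
  have h3 := hb k
  have h4 := hr0 k
  grind

lemma Lp.integrable_of_two [IsFiniteMeasure μ] (f : Lp ℝ 2 μ) : Integrable f μ :=
  (Lp.memLp f).integrable one_le_two

lemma Lp.integral_abs_le_norm [IsProbabilityMeasure μ] (f : Lp ℝ 2 μ) : ∫ x, |f x| ∂μ ≤ ‖f‖ := by
  simp_rw [← Real.norm_eq_abs]
  rw [integral_norm_eq_lintegral_enorm (Lp.aestronglyMeasurable f), Lp.norm_def,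
    ← eLpNorm_one_eq_lintegral_enorm]
  exact ENNReal.toReal_mono (Lp.eLpNorm_ne_top f)
    (eLpNorm_le_eLpNorm_of_exponent_le one_le_two (Lp.aestronglyMeasurable f))

/-- The maximal inequality for the averages of an operator which contracts the `L¹`- and the
`L^∞`-norms; no positivity of the operator is needed. -/
lemma mul_measure_exists_lt_sum_le [IsProbabilityMeasure μ] (S : Lp ℝ 2 μ →L[ℝ] Lp ℝ 2 μ)
    (h1 : ∀ X : Lp ℝ 2 μ, ∫ x, |S X x| ∂μ ≤ ∫ x, |X x| ∂μ)
    (hi : ∀ (X : Lp ℝ 2 μ) (C : ℝ), (∀ᵐ x ∂μ, |X x| ≤ C) → ∀ᵐ x ∂μ, |S X x| ≤ C)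
    (f : Lp ℝ 2 μ) {c : ℝ} (hc : 0 < c) :
    ENNReal.ofReal c * μ {x | ∃ n : ℕ, n * c < |∑ m ∈ Finset.range n, (S ^ m) f x|} ≤
      ENNReal.ofReal ‖f‖ := by
  obtain ⟨h, r, b, hh0, hh, hae⟩ := exists_filling_scheme S f c
  have hr0 : ∀ᵐ x ∂μ, ∀ n, 0 ≤ r n x := hae.mono fun x hx n =>
    filling_room_nonneg (h := (h · x)) (r := (r · x)) (b := (b · x)) hc.le hx.1
      (fun n => (hx.2 n).1) (fun n => (hx.2 n).2.1) n
  have hint (X : Lp ℝ 2 μ) : Integrable (fun x => |X x|) μ := (Lp.integrable_of_two X).abs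
  have hroom (n : ℕ) : Integrable (fun x => c - r n x) μ :=
    (integrable_const c).sub (Lp.integrable_of_two _)
  have hmass (n : ℕ) : ∫ x, (c - r n x) ∂μ + ∫ x, |h n x| ∂μ ≤ ∫ x, |f x| ∂μ := by
    induction n with
    | zero =>
      rw [hh0, integral_congr_ae (g := fun _ => 0)]
      · simp
      · filter_upwards [hae] with x hx
        simp [hx.1]
    | succ n ih =>
      have e1 : ∫ x, (c - r (n + 1) x) ∂μ = ∫ x, (c - r n x) ∂μ + ∫ x, |b n x| ∂μ := by
        rw [← integral_add (hroom n) (hint _)]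
        refine integral_congr_ae ?_
        filter_upwards [hae] with x hx
        rw [(hx.2 n).2.1]; ring
      have e2 : ∫ x, |h n x| ∂μ = ∫ x, |b n x| ∂μ + ∫ x, |(h n - b n : Lp ℝ 2 μ) x| ∂μ := by
        rw [← integral_add (hint _) (hint _)]
        refine integral_congr_ae ?_
        filter_upwards [hae, hr0] with x hx hx0
        rw [(hx.2 n).2.2]
        exact filling_abs_split (h := (h · x)) (r := (r · x)) (b := (b · x)) (hx0 n) (hx.2 n).1
      have e3 := h1 (h n - b n)
      rw [← hh] at e3
      linarith
  let G : ℕ → Lp ℝ 2 μ := fun n =>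
    Nat.rec 0 (fun k g => ∑ j ∈ Finset.range (k + 1), b j + S g) n
  have hG (n : ℕ) : G (n + 1) = ∑ j ∈ Finset.range (n + 1), b j + S (G n) := rfl
  have hGbound (n : ℕ) : ∀ᵐ x ∂μ, |G n x| ≤ n * c := by
    induction n with
    | zero =>
      filter_upwards [Lp.coeFn_zero ℝ 2 μ] with x hx
      have : G 0 x = 0 := hx
      simp [this]
    | succ n ih =>
      rw [hG]
      filter_upwards [hi _ _ ih, hae, hr0, Lp.coeFn_fun_finsetSum (Finset.range (n + 1)) b,
        Lp.coeFn_add (∑ j ∈ Finset.range (n + 1), b j) (S (G n))] with x k1 k2 k3 k4 k5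
      rw [k5, Pi.add_apply, k4]
      refine (abs_add_le _ _).trans ?_
      have := filling_abs_sum_le (r := (r · x)) (b := (b · x)) k2.1 k3
        (fun n => (k2.2 n).2.1) (n + 1)
      push_cast
      linarith
  have hsum (n : ℕ) : ∑ m ∈ Finset.range n, (S ^ m) f =
      G n + ∑ m ∈ Finset.range n, (h m - b m) := by
    induction n with
    | zero => simp [G]
    | succ n ih =>
      have hshift : ∑ m ∈ Finset.range (n + 1), h m =
          S (∑ m ∈ Finset.range n, (h m - b m)) + f := by
        rw [Finset.sum_range_succ', hh0, map_sum]
        simp_rw [hh]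
      have hiter : ∑ m ∈ Finset.range (n + 1), (S ^ m) f =
          S (∑ m ∈ Finset.range n, (S ^ m) f) + f := by
        rw [Finset.sum_range_succ', map_sum]
        simp [pow_succ']
      rw [hiter, ih, map_add, hG, Finset.sum_sub_distrib h b (s := Finset.range (n + 1)), hshift]
      abel
  have hpt : ∀ᵐ x ∂μ, ∀ N : ℕ, 0 < r N x →
      ∀ n ≤ N, |∑ m ∈ Finset.range n, (S ^ m) f x| ≤ n * c := by
    filter_upwards [hae, hr0, ae_all_iff.2 hGbound,
      ae_all_iff.2 fun n => Lp.coeFn_fun_finsetSum (Finset.range n) fun m => (S ^ m) f,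
      ae_all_iff.2 fun n => Lp.coeFn_fun_finsetSum (Finset.range n) fun m => h m - b m,
      ae_all_iff.2 fun n => Lp.coeFn_add (G n) (∑ m ∈ Finset.range n, (h m - b m))]
      with x k1 k2 k3 k4 k5 k6 N hN n hn
    rw [← k4, hsum, k6, Pi.add_apply, k5, Finset.sum_eq_zero, add_zero]
    · exact k3 n
    · intro m hm
      rw [(k1.2 m).2.2]
      exact filling_excess_eq_zero (h := (h · x)) (r := (r · x)) (b := (b · x)) k2
        (fun n => (k1.2 n).1) (fun n => (k1.2 n).2.1) hN ((Finset.mem_range.1 hm).trans_le hn)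
  have hfin (N : ℕ) : ENNReal.ofReal c *
      μ {x | ∃ n ≤ N, (n : ℝ) * c < |∑ m ∈ Finset.range n, (S ^ m) f x|} ≤
        ENNReal.ofReal ‖f‖ := by
    have hsub : μ {x | ∃ n ≤ N, (n : ℝ) * c < |∑ m ∈ Finset.range n, (S ^ m) f x|} ≤
        μ {x | c ≤ c - r N x} := by
      refine measure_mono_ae ?_
      filter_upwards [hpt] with x hx
      rintro ⟨n, hn, hlt⟩
      by_contra hcon
      have hpos : 0 < r N x := by
        have : ¬ (c ≤ c - r N x) := hcon
        linarith
      exact absurd (hx N hpos n hn) (not_le.2 hlt)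
    have hmarkov := mul_meas_ge_le_integral_of_nonneg (μ := μ) (f := fun x => c - r N x) ?_
      (hroom N) c
    · have hle : c * μ.real {x | c ≤ c - r N x} ≤ ‖f‖ := by
        have : 0 ≤ ∫ x, |h N x| ∂μ := integral_nonneg fun x => abs_nonneg _
        linarith [hmass N, Lp.integral_abs_le_norm f]
      calc _ ≤ ENNReal.ofReal c * μ {x | c ≤ c - r N x} := by gcongr
        _ = ENNReal.ofReal (c * μ.real {x | c ≤ c - r N x}) := by
          rw [ENNReal.ofReal_mul hc.le, ofReal_measureReal]
        _ ≤ _ := ENNReal.ofReal_le_ofReal hle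
    · filter_upwards [hae] with x hx
      have := filling_room_antitone (r := (r · x)) (b := (b · x)) (fun n => (hx.2 n).2.1)
        (Nat.zero_le N)
      simp only [hx.1] at this
      simpa using this
  have hunion : {x | ∃ n : ℕ, n * c < |∑ m ∈ Finset.range n, (S ^ m) f x|} =
      ⋃ N : ℕ, {x | ∃ n ≤ N, (n : ℝ) * c < |∑ m ∈ Finset.range n, (S ^ m) f x|} := by
    ext x
    simp only [Set.mem_ofPred_eq, Set.mem_iUnion]
    exact ⟨fun ⟨n, hn⟩ => ⟨n, n, le_rfl, hn⟩, fun ⟨_, n, _, hn⟩ => ⟨n, hn⟩⟩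
  have hmono : Monotone fun N : ℕ =>
      {x | ∃ n ≤ N, (n : ℝ) * c < |∑ m ∈ Finset.range n, (S ^ m) f x|} := by
    rintro M N hMN x ⟨n, hn, hlt⟩
    exact ⟨n, hn.trans hMN, hlt⟩
  rw [hunion, hmono.measure_iUnion, ENNReal.mul_iSup]
  exact iSup_le hfin

end FillingScheme

section AlmostEverywhere

variable {Ω : Type*} [MeasurableSpace Ω] {μ : Measure Ω}

lemma Lp.integral_sq_eq_norm_sq (f : Lp ℝ 2 μ) : ∫ x, f x ^ 2 ∂μ = ‖f‖ ^ 2 := by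
  rw [← real_inner_self_eq_norm_sq, L2.inner_def]
  simp [pow_two]

lemma IsSelfAdjoint.ae_summable_mul_sq {T : Lp ℝ 2 μ →L[ℝ] Lp ℝ 2 μ} (hT : IsSelfAdjoint T)
    (hT1 : ‖T‖ ≤ 1) (X : Lp ℝ 2 μ) :
    ∀ᵐ x ∂μ, Summable fun k : ℕ =>
      ((k : ℝ) + 1) * (((T ^ 2) ^ k) X x - ((T ^ 2) ^ (k + 1)) X x) ^ 2 := by
  let d : ℕ → Lp ℝ 2 μ := fun k => ((T ^ 2) ^ k) X - ((T ^ 2) ^ (k + 1)) X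
  have hint (k : ℕ) : Integrable (fun x => ((k : ℝ) + 1) * d k x ^ 2) μ :=
    (Lp.memLp (d k)).integrable_sq.const_mul _
  have hnorm (k : ℕ) : eLpNorm (fun x => ((k : ℝ) + 1) * d k x ^ 2) 1 μ =
      ENNReal.ofReal (((k : ℝ) + 1) * ‖d k‖ ^ 2) := by
    rw [eLpNorm_one_eq_lintegral_enorm, ← Lp.integral_sq_eq_norm_sq, ← integral_const_mul,
      ofReal_integral_eq_lintegral_ofReal (hint k) (Eventually.of_forall fun x => by positivity)]
    exact lintegral_congr fun x => Real.enorm_of_nonneg (by positivity)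
  have hsum : Summable fun k : ℕ => ((k : ℝ) + 1) * ‖d k‖ ^ 2 :=
    summable_of_sum_range_le (fun k => by positivity) (hT.sum_range_mul_norm_sq_le hT1 X)
  have hae := summable_norm_of_tsum_eLpNorm_ne_top le_rfl (fun k => (hint k).aestronglyMeasurable)
    (by simp_rw [hnorm]; exact hsum.tsum_ofReal_ne_top)
  filter_upwards [hae, ae_all_iff.2 fun k : ℕ =>
    Lp.coeFn_sub (((T ^ 2) ^ k) X) (((T ^ 2) ^ (k + 1)) X)] with x hx hd
  refine hx.of_norm.congr fun k => ?_
  have : d k x = ((T ^ 2) ^ k) X x - ((T ^ 2) ^ (k + 1)) X x := hd k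
  rw [this]

lemma Lp.eLpNorm_top_le_iff {p : ℝ≥0∞} (f : Lp ℝ p μ) {C : ℝ} (hC : 0 ≤ C) :
    eLpNorm f ⊤ μ ≤ ENNReal.ofReal C ↔ ∀ᵐ x ∂μ, |f x| ≤ C := by
  rw [eLpNorm_exponent_top]
  constructor
  · intro h
    filter_upwards [ae_le_eLpNormEssSup (f := f) (μ := μ)] with x hx
    have := hx.trans h
    rwa [Real.enorm_eq_ofReal_abs, ENNReal.ofReal_le_ofReal_iff hC] at this
  · exact fun h => eLpNormEssSup_le_of_ae_bound h

lemma ae_abs_apply_le_of_eLpNorm_top_le [NeZero μ] {T : Lp ℝ 2 μ →L[ℝ] Lp ℝ 2 μ}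
    (hi : ∀ X : Lp ℝ 2 μ, eLpNorm (T X) ⊤ μ ≤ eLpNorm X ⊤ μ) (X : Lp ℝ 2 μ) (C : ℝ)
    (hX : ∀ᵐ x ∂μ, |X x| ≤ C) : ∀ᵐ x ∂μ, |T X x| ≤ C := by
  have hC : 0 ≤ C := by
    obtain ⟨x, hx⟩ := hX.exists
    exact (abs_nonneg _).trans hx
  exact (Lp.eLpNorm_top_le_iff _ hC).1 ((hi X).trans ((Lp.eLpNorm_top_le_iff X hC).2 hX))

lemma integral_abs_apply_le_of_eLpNorm_one_le [IsFiniteMeasure μ]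
    {T : Lp ℝ 2 μ →L[ℝ] Lp ℝ 2 μ} (h1 : ∀ X : Lp ℝ 2 μ, eLpNorm (T X) 1 μ ≤ eLpNorm X 1 μ)
    (X : Lp ℝ 2 μ) : ∫ x, |T X x| ∂μ ≤ ∫ x, |X x| ∂μ := by
  simp_rw [← Real.norm_eq_abs]
  rw [integral_norm_eq_lintegral_enorm (Lp.aestronglyMeasurable _),
    integral_norm_eq_lintegral_enorm (Lp.aestronglyMeasurable _),
    ← eLpNorm_one_eq_lintegral_enorm, ← eLpNorm_one_eq_lintegral_enorm]
  exact ENNReal.toReal_mono (memLp_one_iff_integrable.2 (Lp.integrable_of_two X)).2.ne (h1 X)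

lemma IsSelfAdjoint.opNorm_le_one_of_eLpNorm_top_le [IsProbabilityMeasure μ]
    {T : Lp ℝ 2 μ →L[ℝ] Lp ℝ 2 μ} (hT : IsSelfAdjoint T)
    (hi : ∀ X : Lp ℝ 2 μ, eLpNorm (T X) ⊤ μ ≤ eLpNorm X ⊤ μ) : ‖T‖ ≤ 1 := by
  refine T.opNorm_le_bound zero_le_one fun X => ?_
  rw [one_mul]
  refine (Lp.simpleFunc.denseRange (E := ℝ) (μ := μ) (p := 2) ENNReal.ofNat_ne_top).induction_on
    (p := fun X => ‖T X‖ ≤ ‖X‖) X (isClosed_le (by fun_prop) (by fun_prop)) fun s => ?_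
  obtain ⟨C, hC⟩ := (Lp.simpleFunc.toSimpleFunc s).exists_forall_norm_le
  have hs : ∀ᵐ x ∂μ, |(s : Lp ℝ 2 μ) x| ≤ C := by
    filter_upwards [Lp.simpleFunc.toSimpleFunc_eq_toFun s] with x hx
    rw [← hx]
    exact hC x
  have horbit (n : ℕ) : ∀ᵐ x ∂μ, |(T ^ n) (s : Lp ℝ 2 μ) x| ≤ C := by
    induction n with
    | zero => simpa using hs
    | succ n ih =>
      rw [pow_succ', mul_apply_eq_comp]
      exact ae_abs_apply_le_of_eLpNorm_top_le hi _ _ ih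
  refine hT.norm_apply_le_of_bounded_orbit (C := C) fun n => ?_
  have hC0 : 0 ≤ C := by
    obtain ⟨x, hx⟩ := hs.exists
    exact (abs_nonneg _).trans hx
  refine (Lp.norm_le_of_ae_bound hC0 (horbit n)).trans_eq ?_
  simp [measureUnivNNReal]

lemma ae_eventually_abs_sub_le [IsProbabilityMeasure μ] {T Q : Lp ℝ 2 μ →L[ℝ] Lp ℝ 2 μ}
    (hT : IsSelfAdjoint T) (hT1 : ‖T‖ ≤ 1)
    (h1 : ∀ X : Lp ℝ 2 μ, ∫ x, |(T ^ 2) X x| ∂μ ≤ ∫ x, |X x| ∂μ)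
    (hi : ∀ (X : Lp ℝ 2 μ) (C : ℝ), (∀ᵐ x ∂μ, |X x| ≤ C) → ∀ᵐ x ∂μ, |(T ^ 2) X x| ≤ C)
    (hfix : ∀ X, (T ^ 2) (Q X) = Q X)
    (hQ : ∀ X, Tendsto (fun n : ℕ => ((T ^ 2) ^ n) X) atTop (nhds (Q X))) (X : Lp ℝ 2 μ)
    {c : ℝ} (hc : 0 < c) :
    ∀ᵐ x ∂μ, ∀ᶠ n : ℕ in atTop, |((T ^ 2) ^ n) X x - Q X x| ≤ 2 * c := by
  set S := T ^ 2 with hS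
  let h : ℕ → Lp ℝ 2 μ := fun m => (S ^ m) X - Q X
  have hfixn (n : ℕ) : (S ^ n) (Q X) = Q X := by
    induction n with
    | zero => simp
    | succ n ih => rw [pow_succ, mul_apply_eq_comp, hfix, ih]
  have hiter (m n : ℕ) : (S ^ n) (h m) = (S ^ (n + m)) X - Q X := by
    rw [map_sub, hfixn, pow_add, mul_apply_eq_comp]
  have hh : Tendsto (fun m => ENNReal.ofReal ‖h m‖) atTop (nhds 0) := by
    have : Tendsto (fun m => ‖h m‖) atTop (nhds 0) := by
      rw [← norm_zero (E := Lp ℝ 2 μ), ← sub_self (Q X)]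
      exact ((hQ X).sub_const (Q X)).norm
    simpa using ENNReal.tendsto_ofReal this
  have hle (m : ℕ) :
      ENNReal.ofReal c * μ {x | ¬ ∀ᶠ n : ℕ in atTop, |(S ^ n) X x - Q X x| ≤ 2 * c} ≤
        ENNReal.ofReal ‖h m‖ := by
    refine le_trans ?_ (mul_measure_exists_lt_sum_le S h1 hi (h m) hc)
    gcongr ENNReal.ofReal c * ?_
    refine measure_mono_ae ?_
    filter_upwards [hT.ae_summable_mul_sq hT1 (h m), ae_all_iff.2 fun n : ℕ =>
      Lp.coeFn_sub ((S ^ (n + m)) X) (Q X)] with x hx hsub hnot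
    by_contra hcon
    have hbound : ∀ n : ℕ, |∑ k ∈ Finset.range n, (S ^ k) (h m) x| ≤ n * c := by
      intro n
      by_contra! hlt
      exact hcon ⟨n, hlt⟩
    refine hnot ?_
    rw [← map_add_atTop_eq_nat m, eventually_map]
    have hlim := tendsto_average_sub_of_summable hx
    filter_upwards [hlim.abs.eventually_le_const (show |(0 : ℝ)| < c by simpa using hc)] with n hn
    rw [← hS, hiter, hsub, Pi.sub_apply] at hn
    have havg : |(n : ℝ)⁻¹ * ∑ k ∈ Finset.range n, (S ^ k) (h m) x| ≤ c := by
      rw [abs_mul, abs_of_nonneg (by positivity)]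
      rcases n.eq_zero_or_pos with rfl | hn0
      · simpa using hc.le
      · rw [inv_mul_le_iff₀ (by positivity)]
        exact hbound n
    rw [abs_le] at hn havg ⊢
    constructor <;> linarith [hn.1, hn.2, havg.1, havg.2]
  have hzero := le_antisymm (ge_of_tendsto' hh hle) zero_le
  rw [mul_eq_zero] at hzero
  exact hzero.resolve_left (by simpa using hc)

end AlmostEverywhere

/-- If a self-adjoint operator `T` on `L²` of a probability space is a contraction for
both the `L¹`- and `L^∞`-norms, then `‖T‖ ≤ 1` on `L²` and the even iterates `T^{2n}X`
converge almost surely to `QX`, where `Q` is the orthogonal projection arising as the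
strong `L²`-limit of `T^{2n}`. -/
theorem even_iterates_tendsto_ae_of_L1_Linfty_contraction
    {Ω : Type*} [MeasurableSpace Ω] {μ : Measure Ω} [IsProbabilityMeasure μ]
    (T : Lp ℝ 2 μ →L[ℝ] Lp ℝ 2 μ) (hT : IsSelfAdjoint T)
    (h1 : ∀ X : Lp ℝ 2 μ, eLpNorm (T X) 1 μ ≤ eLpNorm X 1 μ)
    (hi : ∀ X : Lp ℝ 2 μ, eLpNorm (T X) ⊤ μ ≤ eLpNorm X ⊤ μ) :
    ‖T‖ ≤ 1 ∧
      ∃ Q : Lp ℝ 2 μ →L[ℝ] Lp ℝ 2 μ, IsSelfAdjoint Q ∧ Q.comp Q = Q ∧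
        (∀ Y : Lp ℝ 2 μ, Tendsto (fun n : ℕ => (T ^ (2 * n)) Y) atTop (nhds (Q Y))) ∧
        ∀ X : Lp ℝ 2 μ,
          ∀ᵐ ω ∂μ, Tendsto (fun n : ℕ => (T ^ (2 * n)) X ω) atTop (nhds (Q X ω)) := by
  have hT1 := hT.opNorm_le_one_of_eLpNorm_top_le hi
  obtain ⟨Q, hQsa, hQidem, hfix, hQ⟩ := hT.exists_tendsto_sq_pow_apply hT1
  have hL1 (X : Lp ℝ 2 μ) : ∫ x, |(T ^ 2) X x| ∂μ ≤ ∫ x, |X x| ∂μ := by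
    rw [pow_two, mul_apply_eq_comp]
    exact (integral_abs_apply_le_of_eLpNorm_one_le h1 _).trans
      (integral_abs_apply_le_of_eLpNorm_one_le h1 X)
  have hLi (X : Lp ℝ 2 μ) (C : ℝ) (hX : ∀ᵐ x ∂μ, |X x| ≤ C) : ∀ᵐ x ∂μ, |(T ^ 2) X x| ≤ C := by
    rw [pow_two, mul_apply_eq_comp]
    exact ae_abs_apply_le_of_eLpNorm_top_le hi _ _ (ae_abs_apply_le_of_eLpNorm_top_le hi _ _ hX)
  simp_rw [pow_mul]
  refine ⟨hT1, Q, hQsa, hQidem, hQ, fun X => ?_⟩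
  have hev := ae_all_iff.2 fun k : ℕ =>
    ae_eventually_abs_sub_le hT hT1 hL1 hLi hfix hQ X (Nat.one_div_pos_of_nat (n := k))
  filter_upwards [hev] with ω hω
  rw [Metric.tendsto_nhds]
  intro ε hε
  obtain ⟨k, hk⟩ := exists_nat_one_div_lt (half_pos hε)
  filter_upwards [hω k] with n hn
  rw [Real.dist_eq]
  linarith
end

section
/- Let $(\Omega, \mathcal{F}, \mathbb{P})$ be a probability space, let $\{\mathcal{G}_n\}_{n\ge 1}$ be sub-$\sigma$-fields of $\mathcal{F}$, let $T_n = \mathbb{E}[\cdot\,|\,\mathcal{G}_n]$ be the corresponding conditional expectation operators on $L_2(\Omega,\mathcal{F},\mathbb{P})$, and set $S_n = T_n \cdots T_2 T_1$. Then for every $X \in L_2$, $S_n X - S_{n+1} X \to 0$ as $n \to \infty$, both in $L_2$-norm and almost surely. -/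
open Filter MeasureTheory
open scoped ENNReal NNReal

/-- Conditional expectation satisfies the Pythagorean identity on `L²`. -/
lemma norm_sq_eq_add_norm_sq_sub_of_ae_eq_condExp
    {Ω : Type*} {m m0 : MeasurableSpace Ω} {μ : Measure Ω} [IsFiniteMeasure μ]
    (hm : m ≤ m0) {X Y : Lp ℝ 2 μ} (hY : (Y : Ω → ℝ) =ᵐ[μ] μ[(X : Ω → ℝ) | m]) :
    ‖X‖ ^ 2 = ‖Y‖ ^ 2 + ‖X - Y‖ ^ 2 := by
  have hproj : (condExpL2 ℝ ℝ hm X : Lp ℝ 2 μ) = Y := by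
    apply Lp.ext
    have h := (Lp.memLp X).condExpL2_ae_eq_condExp (𝕜 := ℝ) hm
    rw [Lp.toLp_coeFn] at h
    exact h.trans hY.symm
  have : Fact (m ≤ m0) := ⟨hm⟩
  have h := (lpMeas ℝ ℝ m 2 μ).norm_sq_eq_add_norm_sq_starProjection X
  rw [Submodule.starProjection_orthogonal_val] at h
  rw [← hproj]
  exact h

/-- A sequence in `L²` with summable squared norms tends to zero almost everywhere. -/
lemma ae_tendsto_zero_of_summable_norm_sq
    {Ω : Type*} {m0 : MeasurableSpace Ω} {μ : Measure Ω}
    {f : ℕ → Lp ℝ 2 μ} (hf : Summable fun n => ‖f n‖ ^ 2) :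
    ∀ᵐ ω ∂μ, Tendsto (fun n => f n ω) atTop (nhds 0) := by
  have hmeas (n : ℕ) : AEMeasurable (fun ω => ‖f n ω‖ₑ ^ 2) μ :=
    (Lp.aestronglyMeasurable (f n)).enorm.pow_const 2
  have hnorm (n : ℕ) : ∫⁻ ω, ‖f n ω‖ₑ ^ 2 ∂μ = ENNReal.ofReal (‖f n‖ ^ 2) := by
    have h := eLpNorm_nnreal_pow_eq_lintegral (f := (f n : Ω → ℝ)) (μ := μ)
      (p := 2) two_ne_zero
    norm_num at h
    rw [← h, ← Lp.enorm_def, ENNReal.ofReal_pow (norm_nonneg _), ofReal_norm]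
  have hfin : ∫⁻ ω, ∑' n, ‖f n ω‖ₑ ^ 2 ∂μ ≠ ∞ := by
    rw [lintegral_tsum hmeas]
    simp_rw [hnorm]
    exact hf.tsum_ofReal_ne_top
  filter_upwards [ae_lt_top' (AEMeasurable.tsum hmeas) hfin] with ω hω
  have h := ENNReal.tendsto_atTop_zero_of_tsum_ne_top hω.ne
  rw [tendsto_zero_iff_enorm_tendsto_zero]
  have h' := (ENNReal.continuous_rpow_const (y := (1 / 2 : ℝ))).continuousAt.tendsto.comp h
  rw [ENNReal.zero_rpow_of_pos one_half_pos] at h'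
  refine h'.congr fun n => ?_
  rw [Function.comp_apply, ← ENNReal.rpow_natCast, ← ENNReal.rpow_mul]
  norm_num

/-- For conditional expectation operators `T n = E[· | G n]` on `L²` and iterates
`S n = T n ∘ ⋯ ∘ T 1`, one has `S n X - S (n+1) X → 0` both in `L²`-norm and
almost surely. -/
theorem iterated_condexp_diff_tendsto_zero
    {Ω : Type*} {m0 : MeasurableSpace Ω} {μ : Measure Ω} [IsProbabilityMeasure μ]
    (G : ℕ → MeasurableSpace Ω) (hG : ∀ n, G n ≤ m0)
    (T : ℕ → Lp ℝ 2 μ →L[ℝ] Lp ℝ 2 μ)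
    (hT : ∀ n (X : Lp ℝ 2 μ), (T n X : Ω → ℝ) =ᵐ[μ] μ[(X : Ω → ℝ) | G n])
    (S : ℕ → Lp ℝ 2 μ →L[ℝ] Lp ℝ 2 μ)
    (hS1 : S 1 = T 1) (hSrec : ∀ n ≥ 1, S (n + 1) = (T (n + 1)).comp (S n))
    (X : Lp ℝ 2 μ) :
    Tendsto (fun n : ℕ => S n X - S (n + 1) X) atTop (nhds 0) ∧
      ∀ᵐ ω ∂μ, Tendsto (fun n : ℕ => S n X ω - S (n + 1) X ω) atTop (nhds 0) := by
  have hpyth (n : ℕ) (hn : 1 ≤ n) :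
      ‖S n X‖ ^ 2 = ‖S (n + 1) X‖ ^ 2 + ‖S n X - S (n + 1) X‖ ^ 2 := by
    refine norm_sq_eq_add_norm_sq_sub_of_ae_eq_condExp (hG (n + 1)) ?_
    rw [hSrec n hn]
    exact hT (n + 1) (S n X)
  have hsum : Summable fun n => ‖S n X - S (n + 1) X‖ ^ 2 := by
    rw [← summable_nat_add_iff 1]
    refine summable_of_sum_range_le (c := ‖S 1 X‖ ^ 2) (fun n => sq_nonneg _) fun N => ?_
    have htel : ∑ n ∈ Finset.range N, ‖S (n + 1) X - S (n + 1 + 1) X‖ ^ 2 =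
        ‖S 1 X‖ ^ 2 - ‖S (N + 1) X‖ ^ 2 := by
      rw [← Finset.sum_range_sub' (fun n => ‖S (n + 1) X‖ ^ 2)]
      exact Finset.sum_congr rfl fun n _ => by linarith [hpyth (n + 1) (by omega)]
    rw [htel]
    linarith [sq_nonneg ‖S (N + 1) X‖]
  constructor
  · rw [tendsto_zero_iff_norm_tendsto_zero]
    simpa using hsum.tendsto_atTop_zero.sqrt
  · have hsub : ∀ᵐ ω ∂μ, ∀ n, (S n X - S (n + 1) X : Lp ℝ 2 μ) ω = S n X ω - S (n + 1) X ω :=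
      ae_all_iff.2 fun n => Lp.coeFn_sub (S n X) (S (n + 1) X)
    filter_upwards [ae_tendsto_zero_of_summable_norm_sq hsum, hsub] with ω hω hωsub
    exact hω.congr hωsub
end

section
/- Let $(\Omega, \mathcal{F})$ be a measurable space with a family of probability measures $\{\mathbb{P}_\gamma\}_{\gamma \in \Gamma}$, and let $\mathcal{N}$ be the $\sigma$-field generated by the sets $N \in \mathcal{F}$ with $\mathbb{P}_\gamma(N) = 0$ for all $\gamma \in \Gamma$. Let $\mathcal{G}_1$ and $\mathcal{G}_2$ be sufficient sub-$\sigma$-fields of $\mathcal{F}$, and suppose $\mathcal{N} \subseteq \mathcal{G}_1$ or $\mathcal{N} \subseteq \mathcal{G}_2$. Then $\mathcal{G}_1 \cap \mathcal{G}_2$ is a sufficient sub-$\sigma$-field of $\mathcal{F}$. -/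
open MeasureTheory

/-- A sub-σ-field `G` of `m0` is sufficient for the family of probability measures `P`
if for every bounded `m0`-measurable `f` there is a `G`-measurable `g` (integrable for
each `P γ`) with `∫_s f dP γ = ∫_s g dP γ` for all `γ` and all `G`-measurable `s`,
i.e. `g` is a version of `E_γ[f | G]` simultaneously for all `γ`. -/
def IsSufficient {Ω Γ : Type*} (m0 : MeasurableSpace Ω)
    (P : Γ → @Measure Ω m0) (G : MeasurableSpace Ω) : Prop :=
  G ≤ m0 ∧
    ∀ f : Ω → ℝ, Measurable[m0] f → (∃ C : ℝ, ∀ ω, |f ω| ≤ C) →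
      ∃ g : Ω → ℝ, Measurable[G] g ∧ (∀ γ, Integrable g (P γ)) ∧
        ∀ γ, ∀ s : Set Ω, MeasurableSet[G] s →
          ∫ ω in s, f ω ∂(P γ) = ∫ ω in s, g ω ∂(P γ)

/-- The composition of two conditional expectations, first on `m1`, then on `m2`. -/
noncomputable def altCondExp {Ω : Type*} (m1 m2 : MeasurableSpace Ω) {m0 : MeasurableSpace Ω}
    (μ : Measure Ω) (f : Ω → ℝ) : Ω → ℝ :=
  μ[μ[f | m1] | m2]

/-- The limit superior of a bounded real sequence, as an infimum of tail suprema. -/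
noncomputable def limTailSup {Ω : Type*} (A : ℕ → Ω → ℝ) (ω : Ω) : ℝ :=
  ⨅ n, ⨆ k, A (n + k) ω

/-- The averages `(F 0 + ⋯ + F n) / (n + 1)`. -/
noncomputable def cesaro {Ω : Type*} (F : ℕ → Ω → ℝ) (n : ℕ) (ω : Ω) : ℝ :=
  (∑ j ∈ Finset.range (n + 1), F j ω) / (n + 1)

section AltCondExp

variable {Ω : Type*} {m1 m2 m0 : MeasurableSpace Ω} {μ : Measure Ω}

theorem integrable_altCondExp {f : Ω → ℝ} : Integrable (altCondExp m1 m2 μ f) μ :=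
  integrable_condExp

theorem altCondExp_congr {f g : Ω → ℝ} (h : f =ᵐ[μ] g) :
    altCondExp m1 m2 μ f =ᵐ[μ] altCondExp m1 m2 μ g :=
  condExp_congr_ae (condExp_congr_ae h)

theorem altCondExp_add {f g : Ω → ℝ} (hf : Integrable f μ) (hg : Integrable g μ) :
    altCondExp m1 m2 μ (f + g) =ᵐ[μ] altCondExp m1 m2 μ f + altCondExp m1 m2 μ g :=
  (condExp_congr_ae (condExp_add hf hg m1)).trans
    (condExp_add integrable_condExp integrable_condExp m2)

theorem altCondExp_sub {f g : Ω → ℝ} (hf : Integrable f μ) (hg : Integrable g μ) :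
    altCondExp m1 m2 μ (f - g) =ᵐ[μ] altCondExp m1 m2 μ f - altCondExp m1 m2 μ g :=
  (condExp_congr_ae (condExp_sub hf hg m1)).trans
    (condExp_sub integrable_condExp integrable_condExp m2)

theorem altCondExp_smul (c : ℝ) (f : Ω → ℝ) :
    altCondExp m1 m2 μ (c • f) =ᵐ[μ] c • altCondExp m1 m2 μ f :=
  (condExp_congr_ae (condExp_smul c f m1)).trans (condExp_smul c _ m2)

theorem altCondExp_sum {s : Finset ℕ} {F : ℕ → Ω → ℝ} (hF : ∀ j ∈ s, Integrable (F j) μ) :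
    altCondExp m1 m2 μ (∑ j ∈ s, F j) =ᵐ[μ] ∑ j ∈ s, altCondExp m1 m2 μ (F j) :=
  (condExp_congr_ae (condExp_finsetSum hF m1)).trans
    (condExp_finsetSum (fun _ _ => integrable_condExp) m2)

theorem altCondExp_mono {f g : Ω → ℝ} (hf : Integrable f μ) (hg : Integrable g μ)
    (h : f ≤ᵐ[μ] g) : altCondExp m1 m2 μ f ≤ᵐ[μ] altCondExp m1 m2 μ g :=
  condExp_mono integrable_condExp integrable_condExp (condExp_mono hf hg h)

theorem altCondExp_nonneg {f : Ω → ℝ} (h : 0 ≤ᵐ[μ] f) : 0 ≤ᵐ[μ] altCondExp m1 m2 μ f :=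
  condExp_nonneg (condExp_nonneg h)

theorem altCondExp_const [IsProbabilityMeasure μ] (hm1 : m1 ≤ m0) (hm2 : m2 ≤ m0) (c : ℝ) :
    altCondExp m1 m2 μ (fun _ => c) = fun _ => c := by
  rw [altCondExp, condExp_const hm1, condExp_const hm2]

theorem setIntegral_altCondExp [IsProbabilityMeasure μ] (hm1 : m1 ≤ m0) (hm2 : m2 ≤ m0)
    {f : Ω → ℝ} (hf : Integrable f μ) {s : Set Ω} (hs1 : MeasurableSet[m1] s)
    (hs2 : MeasurableSet[m2] s) :
    ∫ ω in s, altCondExp m1 m2 μ f ω ∂μ = ∫ ω in s, f ω ∂μ := by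
  rw [altCondExp, setIntegral_condExp hm2 integrable_condExp hs2, setIntegral_condExp hm1 hf hs1]

theorem integral_abs_altCondExp_le (f : Ω → ℝ) :
    ∫ ω, |altCondExp m1 m2 μ f ω| ∂μ ≤ ∫ ω, |f ω| ∂μ :=
  (integral_abs_condExp_le _).trans (integral_abs_condExp_le _)

/-- The iteration `W ↦ (h + T W)⁺` used in the proof of the maximal ergodic lemma. -/
noncomputable def garsiaIter (m1 m2 : MeasurableSpace Ω) {m0 : MeasurableSpace Ω}
    (μ : Measure Ω) (h : Ω → ℝ) : ℕ → Ω → ℝ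
  | 0 => fun _ => 0
  | n + 1 => fun ω => max (h ω + altCondExp m1 m2 μ (garsiaIter m1 m2 μ h n) ω) 0

theorem integrable_garsiaIter {h : Ω → ℝ} (hh : Integrable h μ) (n : ℕ) :
    Integrable (garsiaIter m1 m2 μ h n) μ := by
  cases n with
  | zero => exact integrable_zero _ _ _
  | succ n => exact (hh.add integrable_altCondExp).pos_part

theorem garsiaIter_le_succ {h : Ω → ℝ} (hh : Integrable h μ) (n : ℕ) :
    garsiaIter m1 m2 μ h n ≤ᵐ[μ] garsiaIter m1 m2 μ h (n + 1) := by
  induction n with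
  | zero => exact Filter.Eventually.of_forall fun ω => le_max_right _ _
  | succ n ih =>
    filter_upwards [altCondExp_mono (m1 := m1) (m2 := m2) (integrable_garsiaIter hh n)
      (integrable_garsiaIter hh (n + 1)) ih] with ω hω
    exact max_le_max (by linarith) le_rfl

theorem sum_le_garsiaIter {H : ℕ → Ω → ℝ} (hH : ∀ j, Integrable (H j) μ)
    (hT : ∀ j, altCondExp m1 m2 μ (H j) =ᵐ[μ] H (j + 1)) (n : ℕ) :
    ∑ j ∈ Finset.range n, H j ≤ᵐ[μ] garsiaIter m1 m2 μ (H 0) n := by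
  induction n with
  | zero => exact Filter.Eventually.of_forall fun ω => by simp [garsiaIter]
  | succ n ih =>
    filter_upwards [altCondExp_mono (m1 := m1) (m2 := m2)
      (integrable_finsetSum' _ fun j _ => hH j)
      (integrable_garsiaIter (hH 0) n) ih, altCondExp_sum (m1 := m1) (m2 := m2)
      (s := Finset.range n) (fun j _ => hH j), ae_all_iff.2 hT] with ω h1 h2 h3
    rw [h2] at h1
    refine le_trans ?_ (le_max_left _ _)
    simp only [Finset.sum_apply, h3] at h1 ⊢
    rw [Finset.sum_range_succ']
    linarith

/-- A maximal ergodic lemma for the product of two conditional expectations. -/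
theorem setIntegral_nonneg_of_exists_sum_pos [IsProbabilityMeasure μ]
    (hm1 : m1 ≤ m0) (hm2 : m2 ≤ m0)
    {H : ℕ → Ω → ℝ} (hH : ∀ j, Integrable (H j) μ)
    (hT : ∀ j, altCondExp m1 m2 μ (H j) =ᵐ[μ] H (j + 1))
    (hpos : ∀ᵐ ω ∂μ, ∃ n, 0 < ∑ j ∈ Finset.range n, H j ω)
    {s : Set Ω} (hs1 : MeasurableSet[m1] s) (hs2 : MeasurableSet[m2] s) :
    0 ≤ ∫ ω in s, H 0 ω ∂μ := by
  set W := garsiaIter m1 m2 μ (H 0) with hW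
  have hWi : ∀ n, Integrable (W n) μ := integrable_garsiaIter (hH 0)
  have hWmono : ∀ᵐ ω ∂μ, ∀ n, W n ω ≤ W (n + 1) ω := ae_all_iff.2 (garsiaIter_le_succ (hH 0))
  have hWsum : ∀ᵐ ω ∂μ, ∀ n, (∑ j ∈ Finset.range n, H j) ω ≤ W n ω :=
    ae_all_iff.2 (sum_le_garsiaIter hH hT)
  have hWnn : ∀ n ω, 0 ≤ W n ω := by
    intro n ω
    cases n with
    | zero => exact le_rfl
    | succ n => exact le_max_right _ _
  let g : ℕ → Ω → ℝ := fun n ω => if 0 < W (n + 1) ω then H 0 ω else 0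
  have hgm : ∀ n, AEStronglyMeasurable (g n) μ := by
    intro n
    have hset : NullMeasurableSet {ω | 0 < W (n + 1) ω} μ :=
      nullMeasurableSet_lt aemeasurable_const (hWi (n + 1)).aestronglyMeasurable.aemeasurable
    exact (hH 0).aestronglyMeasurable.indicator₀ hset
  have hgle : ∀ n ω, ‖g n ω‖ ≤ ‖H 0 ω‖ := by
    intro n ω
    simp only [g]
    split_ifs <;> simp
  have hgi : ∀ n, Integrable (g n) μ := fun n =>
    (hH 0).mono (hgm n) (Filter.Eventually.of_forall (hgle n))
  have hgnn : ∀ n, 0 ≤ ∫ ω in s, g n ω ∂μ := by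
    intro n
    have h1 : ∫ ω in s, W n ω ∂μ ≤ ∫ ω in s, W (n + 1) ω ∂μ :=
      setIntegral_mono_ae (hWi n).integrableOn (hWi (n + 1)).integrableOn
        (hWmono.mono fun ω h => h n)
    have h2 : ∫ ω in s, W (n + 1) ω ∂μ ≤
        ∫ ω in s, (g n ω + altCondExp m1 m2 μ (W n) ω) ∂μ := by
      refine setIntegral_mono_ae (hWi (n + 1)).integrableOn
        ((hgi n).add integrable_altCondExp).integrableOn ?_
      filter_upwards [altCondExp_nonneg (m1 := m1) (m2 := m2) (μ := μ)
        (Filter.Eventually.of_forall (hWnn n))] with ω hω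
      have hω' : (0 : ℝ) ≤ altCondExp m1 m2 μ (W n) ω := hω
      simp only [g]
      split_ifs with hc
      · have hmax : W (n + 1) ω = max (H 0 ω + altCondExp m1 m2 μ (W n) ω) 0 := rfl
        rcases max_choice (H 0 ω + altCondExp m1 m2 μ (W n) ω) 0 with h | h <;> linarith
      · linarith
    rw [integral_add (hgi n).integrableOn integrable_altCondExp.integrableOn,
      setIntegral_altCondExp hm1 hm2 (hWi n) hs1 hs2] at h2
    linarith
  refine ge_of_tendsto' (tendsto_integral_of_dominated_convergence (fun ω => ‖H 0 ω‖)
    (fun n => (hgm n).restrict) (hH 0).norm.integrableOn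
    (fun n => Filter.Eventually.of_forall (hgle n)) (ae_restrict_of_ae ?_)) hgnn
  filter_upwards [hWmono, hWsum, hpos] with ω hmono hsum ⟨n, hn⟩
  refine tendsto_const_nhds.congr' ?_
  filter_upwards [Filter.eventually_ge_atTop n] with k hk
  have h1 := hsum n
  rw [Finset.sum_apply] at h1
  have h2 : W n ω ≤ W (k + 1) ω :=
    monotone_nat_of_le_succ (f := fun i => W i ω) hmono (by omega)
  simp only [g]
  rw [if_pos (by linarith)]

theorem ae_eq_of_condExp_eq_of_condExp_eq [IsProbabilityMeasure μ]
    (hm1 : m1 ≤ m0) (hm2 : m2 ≤ m0) {u : Ω → ℝ} (hum : AEStronglyMeasurable u μ) {C : ℝ}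
    (hu : ∀ ω, |u ω| ≤ C) (h : altCondExp m1 m2 μ u =ᵐ[μ] u) :
    μ[u | m1] =ᵐ[μ] u ∧ μ[u | m2] =ᵐ[μ] u := by
  have hui : Integrable u μ := Integrable.of_bound hum C (Filter.Eventually.of_forall hu)
  set w := μ[u | m1] with hw
  have hwb : ∀ᵐ ω ∂μ, |w ω| ≤ C :=
    ae_bdd_abs_condExp_of_ae_bdd_abs (Filter.Eventually.of_forall hu)
  have hwi : Integrable w μ := integrable_condExp
  have hwu : Integrable (w * u) μ := hui.bdd_mul hwi.aestronglyMeasurable hwb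
  have hww : Integrable (w * w) μ := hwi.bdd_mul hwi.aestronglyMeasurable hwb
  have huu : Integrable (u * u) μ := hui.bdd_mul hum (Filter.Eventually.of_forall hu)
  have h1 : ∫ ω, (w * u) ω ∂μ = ∫ ω, (w * w) ω ∂μ := by
    rw [← integral_condExp hm1]
    exact integral_congr_ae (condExp_mul_of_stronglyMeasurable_left stronglyMeasurable_condExp
      hwu hui)
  have h2 : ∫ ω, (w * u) ω ∂μ = ∫ ω, (u * u) ω ∂μ := by
    have hum2 : AEStronglyMeasurable[m2] u μ :=
      ⟨_, stronglyMeasurable_condExp, h.symm⟩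
    rw [← integral_condExp hm2]
    refine integral_congr_ae ((condExp_mul_of_aestronglyMeasurable_right hum2 hwu hwi).trans ?_)
    exact h.mul (Filter.EventuallyEq.refl _ u)
  have hsq : (fun ω => (w ω - u ω) ^ 2) = (w * w - w * u) + (u * u - w * u) := by
    funext ω
    simp only [Pi.mul_apply, Pi.add_apply, Pi.sub_apply]
    ring
  have h3 : ∫ ω, (w ω - u ω) ^ 2 ∂μ = 0 := by
    rw [hsq, integral_add' (hww.sub hwu) (huu.sub hwu), integral_sub' hww hwu,
      integral_sub' huu hwu]
    linarith
  have h3i : Integrable (fun ω => (w ω - u ω) ^ 2) μ :=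
    hsq ▸ (hww.sub hwu).add (huu.sub hwu)
  have h4 : w =ᵐ[μ] u := by
    filter_upwards [(integral_eq_zero_iff_of_nonneg (fun ω => sq_nonneg _) h3i).1 h3] with ω hω
    have : (w ω - u ω) ^ 2 = 0 := hω
    linarith [pow_eq_zero_iff (two_ne_zero) |>.1 this]
  exact ⟨h4, (condExp_congr_ae h4.symm).trans h⟩

end AltCondExp

section LimTailSup

variable {Ω : Type*} {A : ℕ → Ω → ℝ} {C : ℝ}

theorem bddAbove_tail (hA : ∀ n ω, |A n ω| ≤ C) (n : ℕ) (ω : Ω) :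
    BddAbove (Set.range fun k => A (n + k) ω) :=
  ⟨C, by rintro _ ⟨k, rfl⟩; exact (abs_le.1 (hA _ ω)).2⟩

theorem le_tailSup (hA : ∀ n ω, |A n ω| ≤ C) (n k : ℕ) (ω : Ω) :
    A (n + k) ω ≤ ⨆ k, A (n + k) ω :=
  le_ciSup (bddAbove_tail hA n ω) k

theorem abs_tailSup_le (hA : ∀ n ω, |A n ω| ≤ C) (n : ℕ) (ω : Ω) :
    |⨆ k, A (n + k) ω| ≤ C :=
  abs_le.2 ⟨(abs_le.1 (hA (n + 0) ω)).1.trans (le_tailSup hA n 0 ω),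
    ciSup_le fun k => (abs_le.1 (hA (n + k) ω)).2⟩

theorem antitone_tailSup (hA : ∀ n ω, |A n ω| ≤ C) (ω : Ω) :
    Antitone fun n => ⨆ k, A (n + k) ω := by
  refine antitone_nat_of_succ_le fun n => ciSup_le fun k => ?_
  have := le_tailSup hA n (1 + k) ω
  rwa [← add_assoc] at this

theorem bddBelow_tailSup (hA : ∀ n ω, |A n ω| ≤ C) (ω : Ω) :
    BddBelow (Set.range fun n => ⨆ k, A (n + k) ω) :=
  ⟨-C, by rintro _ ⟨n, rfl⟩; exact (abs_le.1 (abs_tailSup_le hA n ω)).1⟩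

theorem tendsto_tailSup (hA : ∀ n ω, |A n ω| ≤ C) (ω : Ω) :
    Filter.Tendsto (fun n => ⨆ k, A (n + k) ω) Filter.atTop (nhds (limTailSup A ω)) :=
  tendsto_atTop_ciInf (antitone_tailSup hA ω) (bddBelow_tailSup hA ω)

theorem limTailSup_le_tailSup (hA : ∀ n ω, |A n ω| ≤ C) (n : ℕ) (ω : Ω) :
    limTailSup A ω ≤ ⨆ k, A (n + k) ω :=
  ciInf_le (bddBelow_tailSup hA ω) n

theorem abs_limTailSup_le (hA : ∀ n ω, |A n ω| ≤ C) (ω : Ω) : |limTailSup A ω| ≤ C :=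
  abs_le.2 ⟨le_ciInf fun n => (abs_le.1 (abs_tailSup_le hA n ω)).1,
    (limTailSup_le_tailSup hA 0 ω).trans (abs_le.1 (abs_tailSup_le hA 0 ω)).2⟩

theorem limTailSup_add_limTailSup_neg_nonneg (hA : ∀ n ω, |A n ω| ≤ C) (ω : Ω) :
    0 ≤ limTailSup A ω + limTailSup (fun n ω => -A n ω) ω := by
  have hA' : ∀ n ω, |-A n ω| ≤ C := fun n ω => by rw [abs_neg]; exact hA n ω
  refine ge_of_tendsto' ((tendsto_tailSup hA ω).add (tendsto_tailSup hA' ω)) fun n => ?_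
  linarith [le_tailSup hA n 0 ω, le_tailSup hA' n 0 ω]

theorem measurable_tailSup [MeasurableSpace Ω] (hA : ∀ n, Measurable (A n)) (n : ℕ) :
    Measurable fun ω => ⨆ k, A (n + k) ω :=
  Measurable.iSup fun k => hA (n + k)

theorem measurable_limTailSup [MeasurableSpace Ω] (hA : ∀ n, Measurable (A n)) :
    Measurable (limTailSup A) :=
  Measurable.iInf fun n => measurable_tailSup hA n

theorem abs_cesaro_le {F : ℕ → Ω → ℝ} (hF : ∀ n ω, |F n ω| ≤ C) (n : ℕ) (ω : Ω) :
    |cesaro F n ω| ≤ C := by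
  rw [cesaro, abs_div, abs_of_pos (by positivity : (0 : ℝ) < n + 1), div_le_iff₀ (by positivity)]
  calc |∑ j ∈ Finset.range (n + 1), F j ω|
      ≤ ∑ j ∈ Finset.range (n + 1), |F j ω| := Finset.abs_sum_le_sum_abs _ _
    _ ≤ ∑ _j ∈ Finset.range (n + 1), C := Finset.sum_le_sum fun j _ => hF j ω
    _ = C * (n + 1) := by simp [mul_comm]

theorem measurable_cesaro [MeasurableSpace Ω] {F : ℕ → Ω → ℝ} (hF : ∀ n, Measurable (F n))
    (n : ℕ) : Measurable (cesaro F n) :=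
  (Finset.measurable_fun_sum _ fun j _ => hF j).div_const _

theorem cesaro_neg (F : ℕ → Ω → ℝ) (n : ℕ) (ω : Ω) :
    cesaro (fun n ω => -F n ω) n ω = -cesaro F n ω := by
  simp [cesaro, neg_div]

end LimTailSup

section Ergodic

variable {Ω : Type*} {m1 m2 m0 : MeasurableSpace Ω} {μ : Measure Ω} [IsProbabilityMeasure μ]
  {F : ℕ → Ω → ℝ} {C : ℝ}

theorem cesaro_sub_le_altCondExp_cesaro
    (hFm : ∀ n, Measurable (F n)) (hF : ∀ n ω, |F n ω| ≤ C)
    (hT : ∀ j, altCondExp m1 m2 μ (F j) =ᵐ[μ] F (j + 1)) (n : ℕ) :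
    ∀ᵐ ω ∂μ, cesaro F n ω - 2 * C / (n + 1) ≤ altCondExp m1 m2 μ (cesaro F n) ω := by
  have hFi : ∀ n, Integrable (F n) μ := fun n =>
    Integrable.of_bound (hFm n).aestronglyMeasurable C (Filter.Eventually.of_forall (hF n))
  have hces : cesaro F n = ((n : ℝ) + 1)⁻¹ • ∑ j ∈ Finset.range (n + 1), F j := by
    funext ω
    simp [cesaro, div_eq_inv_mul]
  filter_upwards [altCondExp_smul (m1 := m1) (m2 := m2) (μ := μ) ((n : ℝ) + 1)⁻¹
      (∑ j ∈ Finset.range (n + 1), F j),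
    altCondExp_sum (m1 := m1) (m2 := m2) (s := Finset.range (n + 1)) (fun j _ => hFi j),
    ae_all_iff.2 hT] with ω h1 h2 h3
  rw [← hces, Pi.smul_apply, h2, Finset.sum_apply, smul_eq_mul, ← div_eq_inv_mul] at h1
  simp only [h3] at h1
  rw [h1, cesaro, ← sub_div]
  gcongr
  have h4 := Finset.sum_range_succ' (fun j => F j ω) (n + 1)
  rw [Finset.sum_range_succ] at h4
  linarith [abs_le.1 (hF 0 ω), abs_le.1 (hF (n + 1) ω)]

theorem altCondExp_limTailSup_cesaro (hm1 : m1 ≤ m0) (hm2 : m2 ≤ m0)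
    (hFm : ∀ n, Measurable (F n)) (hF : ∀ n ω, |F n ω| ≤ C)
    (hT : ∀ j, altCondExp m1 m2 μ (F j) =ᵐ[μ] F (j + 1)) :
    altCondExp m1 m2 μ (limTailSup (cesaro F)) =ᵐ[μ] limTailSup (cesaro F) := by
  set A := cesaro F
  set u := limTailSup A
  have hAm : ∀ n, Measurable (A n) := measurable_cesaro hFm
  have hA : ∀ n ω, |A n ω| ≤ C := abs_cesaro_le hF
  let U : ℕ → Ω → ℝ := fun n ω => ⨆ k, A (n + k) ω
  have hAi : ∀ n, Integrable (A n) μ := fun n =>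
    Integrable.of_bound (hAm n).aestronglyMeasurable C (Filter.Eventually.of_forall (hA n))
  have hUi : ∀ n, Integrable (U n) μ := fun n =>
    Integrable.of_bound (measurable_tailSup hAm n).aestronglyMeasurable C
      (Filter.Eventually.of_forall (abs_tailSup_le hA n))
  have hui : Integrable u μ :=
    Integrable.of_bound (measurable_limTailSup hAm).aestronglyMeasurable C
      (Filter.Eventually.of_forall (abs_limTailSup_le hA))
  have hTu : Integrable (altCondExp m1 m2 μ u) μ := integrable_altCondExp
  obtain ⟨ω₀⟩ : Nonempty Ω := μ.nonempty_of_neZero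
  have hC : 0 ≤ C := (abs_nonneg _).trans (hF 0 ω₀)
  have hlow : ∀ n : ℕ, ∀ᵐ ω ∂μ, u ω - 2 * C / (n + 1) ≤ altCondExp m1 m2 μ (U n) ω := by
    intro n
    have hk : ∀ᵐ ω ∂μ, ∀ k, A (n + k) ω - 2 * C / (n + 1) ≤ altCondExp m1 m2 μ (U n) ω := by
      refine ae_all_iff.2 fun k => ?_
      filter_upwards [cesaro_sub_le_altCondExp_cesaro hFm hF hT (n + k),
        altCondExp_mono (m1 := m1) (m2 := m2) (hAi (n + k)) (hUi n)
          (Filter.Eventually.of_forall fun ω => le_tailSup hA n k ω)] with ω h1 h2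
      have h3 : 2 * C / ((n + k : ℕ) + 1 : ℝ) ≤ 2 * C / (n + 1) := by
        push_cast
        gcongr
        linarith [(Nat.cast_nonneg k : (0 : ℝ) ≤ k)]
      linarith
    filter_upwards [hk] with ω hω
    have h1 : (⨆ k, A (n + k) ω) ≤ altCondExp m1 m2 μ (U n) ω + 2 * C / (n + 1) :=
      ciSup_le fun k => by linarith [hω k]
    linarith [limTailSup_le_tailSup hA n ω]
  have hbound : ∀ n : ℕ, ∫ ω, max (u ω - altCondExp m1 m2 μ u ω) 0 ∂μ ≤
      2 * C / (n + 1) + ∫ ω, |U n ω - u ω| ∂μ := by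
    intro n
    have h1 : ∫ ω, max (u ω - altCondExp m1 m2 μ u ω) 0 ∂μ ≤
        ∫ ω, (2 * C / (n + 1) + |altCondExp m1 m2 μ (U n - u) ω|) ∂μ := by
      refine integral_mono_ae (hui.sub hTu).pos_part
        ((integrable_const _).add integrable_altCondExp.abs) ?_
      filter_upwards [hlow n, altCondExp_sub (m1 := m1) (m2 := m2) (hUi n) hui] with ω h2 h3
      rw [Pi.sub_apply] at h3
      rw [h3]
      refine max_le ?_ (by positivity)
      linarith [le_abs_self (altCondExp m1 m2 μ (U n) ω - altCondExp m1 m2 μ u ω)]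
    rw [integral_add (integrable_const _) integrable_altCondExp.abs] at h1
    simp only [integral_const, probReal_univ, one_smul] at h1
    exact h1.trans (add_le_add le_rfl (integral_abs_altCondExp_le (U n - u)))
  have hlim : Filter.Tendsto (fun n : ℕ => 2 * C / (n + 1) + ∫ ω, |U n ω - u ω| ∂μ)
      Filter.atTop (nhds (0 + ∫ _ω, (0 : ℝ) ∂μ)) := by
    refine Filter.Tendsto.add ?_ ?_
    · have := (tendsto_one_div_add_atTop_nhds_zero_nat (𝕜 := ℝ)).const_mul (2 * C)
      simpa [div_eq_mul_inv] using this
    · refine tendsto_integral_of_dominated_convergence (fun _ => 2 * C)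
        (fun n => ((hUi n).sub hui).abs.aestronglyMeasurable) (integrable_const _)
        (fun n => Filter.Eventually.of_forall fun ω => ?_)
        (Filter.Eventually.of_forall fun ω => ?_)
      · rw [Real.norm_eq_abs, abs_abs]
        have h1 : |U n ω| ≤ C := abs_tailSup_le hA n ω
        have h2 : |u ω| ≤ C := abs_limTailSup_le hA ω
        linarith [abs_sub (U n ω) (u ω)]
      · have := ((tendsto_tailSup hA ω).sub_const (u ω)).abs
        simpa [u, U] using this
  have hzero : ∫ ω, max (u ω - altCondExp m1 m2 μ u ω) 0 ∂μ = 0 := by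
    refine le_antisymm ?_ (integral_nonneg fun ω => le_max_right _ _)
    simpa using ge_of_tendsto' hlim hbound
  have hle : u ≤ᵐ[μ] altCondExp m1 m2 μ u := by
    filter_upwards [(integral_eq_zero_iff_of_nonneg (fun ω => le_max_right _ _)
      (hui.sub hTu).pos_part).1 hzero] with ω hω
    have h1 : max (u ω - altCondExp m1 m2 μ u ω) 0 = 0 := hω
    linarith [max_eq_right_iff.1 h1]
  refine ((integral_eq_iff_of_ae_le hui hTu hle).1 ?_).symm
  have := setIntegral_altCondExp hm1 hm2 hui (μ := μ) MeasurableSet.univ MeasurableSet.univ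
  simpa using this.symm

theorem setIntegral_limTailSup_cesaro_le (hm1 : m1 ≤ m0) (hm2 : m2 ≤ m0)
    (hFm : ∀ n, Measurable (F n)) (hF : ∀ n ω, |F n ω| ≤ C)
    (hT : ∀ j, altCondExp m1 m2 μ (F j) =ᵐ[μ] F (j + 1))
    {s : Set Ω} (hs1 : MeasurableSet[m1] s) (hs2 : MeasurableSet[m2] s) :
    ∫ ω in s, limTailSup (cesaro F) ω ∂μ ≤ ∫ ω in s, F 0 ω ∂μ := by
  have hinv := altCondExp_limTailSup_cesaro hm1 hm2 hFm hF hT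
  have hA : ∀ n ω, |cesaro F n ω| ≤ C := abs_cesaro_le hF
  have hFi : ∀ n, Integrable (F n) μ := fun n =>
    Integrable.of_bound (hFm n).aestronglyMeasurable C (Filter.Eventually.of_forall (hF n))
  have hum := measurable_limTailSup (measurable_cesaro hFm)
  have hui : Integrable (limTailSup (cesaro F)) μ :=
    Integrable.of_bound hum.aestronglyMeasurable C
      (Filter.Eventually.of_forall (abs_limTailSup_le hA))
  set u := limTailSup (cesaro F)
  refine le_of_forall_pos_le_add fun ε hε => ?_
  have hci : Integrable (fun _ : Ω => ε) μ := integrable_const _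
  have key := setIntegral_nonneg_of_exists_sum_pos (μ := μ) hm1 hm2
    (H := fun j => F j - u + fun _ => ε) (fun j => ((hFi j).sub hui).add hci)
    (fun j => by
      filter_upwards [altCondExp_add (m1 := m1) (m2 := m2) ((hFi j).sub hui) hci,
        altCondExp_sub (m1 := m1) (m2 := m2) (hFi j) hui, hinv, hT j] with ω h1 h2 h3 h4
      rw [h1, Pi.add_apply, h2, Pi.sub_apply, h3, h4, altCondExp_const hm1 hm2]
      rfl)
    (Filter.Eventually.of_forall fun ω => by
      have h1 : u ω - ε < ⨆ k, cesaro F (0 + k) ω := by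
        linarith [limTailSup_le_tailSup hA 0 ω]
      obtain ⟨k, hk⟩ := exists_lt_of_lt_ciSup h1
      refine ⟨k + 1, ?_⟩
      rw [zero_add, cesaro, lt_div_iff₀ (by positivity)] at hk
      simp only [Pi.add_apply, Pi.sub_apply, Finset.sum_add_distrib, Finset.sum_sub_distrib,
        Finset.sum_const, Finset.card_range, nsmul_eq_mul]
      push_cast
      linarith) hs1 hs2
  rw [integral_add' ((hFi 0).sub hui).integrableOn hci.integrableOn,
    integral_sub' (hFi 0).integrableOn hui.integrableOn] at key
  have hε' : ∫ _ω in s, ε ∂μ ≤ ε := by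
    rw [setIntegral_const, smul_eq_mul]
    exact mul_le_of_le_one_left hε.le measureReal_le_one
  linarith

theorem setIntegral_limTailSup_cesaro (hm1 : m1 ≤ m0) (hm2 : m2 ≤ m0)
    (hFm : ∀ n, Measurable (F n)) (hF : ∀ n ω, |F n ω| ≤ C)
    (hT : ∀ j, altCondExp m1 m2 μ (F j) =ᵐ[μ] F (j + 1))
    {s : Set Ω} (hs1 : MeasurableSet[m1] s) (hs2 : MeasurableSet[m2] s) :
    ∫ ω in s, limTailSup (cesaro F) ω ∂μ = ∫ ω in s, F 0 ω ∂μ := by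
  refine le_antisymm (setIntegral_limTailSup_cesaro_le hm1 hm2 hFm hF hT hs1 hs2) ?_
  let F' : ℕ → Ω → ℝ := fun n ω => -F n ω
  have hFm' : ∀ n, Measurable (F' n) := fun n => (hFm n).neg
  have hF' : ∀ n ω, |F' n ω| ≤ C := fun n ω => by simpa [F'] using hF n ω
  have hT' : ∀ j, altCondExp m1 m2 μ (F' j) =ᵐ[μ] F' (j + 1) := by
    intro j
    have h1 : F' j = (-1 : ℝ) • F j := by
      funext ω
      simp [F']
    rw [h1]
    filter_upwards [altCondExp_smul (m1 := m1) (m2 := m2) (μ := μ) (-1) (F j), hT j] with ω h2 h3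
    rw [h2, Pi.smul_apply, h3]
    simp [F']
  have h1 := setIntegral_limTailSup_cesaro_le hm1 hm2 hFm' hF' hT' hs1 hs2
  have hces : cesaro F' = fun n ω => -cesaro F n ω := by
    funext n ω
    exact cesaro_neg F n ω
  have hi : ∀ G : ℕ → Ω → ℝ, (∀ n, Measurable (G n)) → (∀ n ω, |G n ω| ≤ C) →
      Integrable (limTailSup (cesaro G)) μ := fun G hGm hG =>
    Integrable.of_bound (measurable_limTailSup (measurable_cesaro hGm)).aestronglyMeasurable C
      (Filter.Eventually.of_forall (abs_limTailSup_le (abs_cesaro_le hG)))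
  have h2 : 0 ≤ ∫ ω in s, (limTailSup (cesaro F) ω + limTailSup (cesaro F') ω) ∂μ := by
    refine integral_nonneg fun ω => ?_
    rw [hces]
    exact limTailSup_add_limTailSup_neg_nonneg (abs_cesaro_le hF) ω
  rw [integral_add (hi F hFm hF).integrableOn (hi F' hFm' hF').integrableOn] at h2
  have h3 : ∫ ω in s, F' 0 ω ∂μ = -∫ ω in s, F 0 ω ∂μ := integral_neg _
  linarith

end Ergodic

theorem IsSufficient.exists_bounded_condExp {Ω Γ : Type*} {G m0 : MeasurableSpace Ω}
    {P : Γ → Measure Ω} (hP : ∀ γ, IsProbabilityMeasure (P γ)) (hG : IsSufficient m0 P G)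
    {f : Ω → ℝ} (hfm : Measurable f) {C : ℝ} (hf : ∀ ω, |f ω| ≤ C) :
    ∃ g : Ω → ℝ, Measurable[G] g ∧ (∀ ω, |g ω| ≤ C) ∧
      ∀ γ, (P γ)[f | G] =ᵐ[P γ] g := by
  obtain ⟨g, hgm, hgi, hg⟩ := hG.2 f hfm ⟨C, hf⟩
  rcases isEmpty_or_nonempty Ω with hΩ | ⟨⟨ω₀⟩⟩
  · exact ⟨g, hgm, fun ω => isEmptyElim ω, fun γ => Filter.Eventually.of_forall isEmptyElim⟩
  have hC : 0 ≤ C := (abs_nonneg _).trans (hf ω₀)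
  refine ⟨fun ω => max (-C) (min C (g ω)), ?_, fun ω => ?_, fun γ => ?_⟩
  · exact Measurable.max measurable_const (Measurable.min measurable_const hgm)
  · exact abs_le.2 ⟨le_max_left _ _, max_le (by linarith) (min_le_left _ _)⟩
  · have hfi : Integrable f (P γ) :=
      Integrable.of_bound hfm.aestronglyMeasurable C (Filter.Eventually.of_forall hf)
    have h1 : g =ᵐ[P γ] (P γ)[f | G] :=
      ae_eq_condExp_of_forall_setIntegral_eq hG.1 hfi (fun _ _ _ => (hgi γ).integrableOn)
        (fun s hs _ => (hg γ s hs).symm) hgm.stronglyMeasurable.aestronglyMeasurable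
    have h2 : ∀ᵐ ω ∂(P γ), |(P γ)[f | G] ω| ≤ C :=
      ae_bdd_abs_condExp_of_ae_bdd_abs (Filter.Eventually.of_forall hf)
    filter_upwards [h1, h2] with ω h3 h4
    rw [← h3] at h4 ⊢
    rw [min_eq_right (abs_le.1 h4).2, max_eq_right (abs_le.1 h4).1]

theorem measurable_of_ae_eq_of_null_le {Ω Γ : Type*} {G m0 : MeasurableSpace Ω}
    {P : Γ → Measure Ω} (hG : G ≤ m0)
    (hN : MeasurableSpace.generateFrom
      {s : Set Ω | MeasurableSet[m0] s ∧ ∀ γ, P γ s = 0} ≤ G)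
    {g h : Ω → ℝ} (hg : Measurable[G] g) (hh : Measurable h) (hgh : ∀ γ, g =ᵐ[P γ] h) :
    Measurable[G] h := by
  have hnull : ∀ s, MeasurableSet[m0] s → (∀ γ, P γ s = 0) → MeasurableSet[G] s := fun s hs h0 =>
    hN _ (MeasurableSpace.measurableSet_generateFrom ⟨hs, h0⟩)
  have hg0 : Measurable g := hg.mono hG le_rfl
  have hD : MeasurableSet[m0] {ω | g ω ≠ h ω} := (measurableSet_eq_fun hg0 hh).compl
  have hD0 : ∀ γ, P γ {ω | g ω ≠ h ω} = 0 := fun γ => ae_iff.1 (hgh γ)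
  intro t ht
  have hsplit : h ⁻¹' t = (g ⁻¹' t \ {ω | g ω ≠ h ω}) ∪ (h ⁻¹' t ∩ {ω | g ω ≠ h ω}) := by
    ext ω
    by_cases hω : g ω = h ω <;> simp [hω]
  rw [hsplit]
  exact ((hg ht).diff (hnull _ hD hD0)).union (hnull _ ((hh ht).inter hD) fun γ =>
    measure_mono_null Set.inter_subset_right (hD0 γ))

theorem IsSufficient.inf_of_null_le_left {Ω Γ : Type*} {G1 G2 m0 : MeasurableSpace Ω}
    {P : Γ → Measure Ω} (hP : ∀ γ, IsProbabilityMeasure (P γ))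
    (h1 : IsSufficient m0 P G1) (h2 : IsSufficient m0 P G2)
    (hN : MeasurableSpace.generateFrom
      {s : Set Ω | MeasurableSet[m0] s ∧ ∀ γ, P γ s = 0} ≤ G1) :
    IsSufficient m0 P (G1 ⊓ G2) := by
  refine ⟨inf_le_left.trans h1.1, fun f hfm ⟨C, hf⟩ => ?_⟩
  have step : ∀ φ : {φ : Ω → ℝ // Measurable φ ∧ ∀ ω, |φ ω| ≤ C},
      ∃ ψ : {φ : Ω → ℝ // Measurable φ ∧ ∀ ω, |φ ω| ≤ C},
        ∀ γ, altCondExp G1 G2 (P γ) φ.1 =ᵐ[P γ] ψ.1 := by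
    rintro ⟨φ, hφm, hφ⟩
    obtain ⟨g, hgm, hg, hgc⟩ := h1.exists_bounded_condExp hP hφm hφ
    obtain ⟨k, hkm, hk, hkc⟩ := h2.exists_bounded_condExp hP (hgm.mono h1.1 le_rfl) hg
    exact ⟨⟨k, hkm.mono h2.1 le_rfl, hk⟩, fun γ => (condExp_congr_ae (hgc γ)).trans (hkc γ)⟩
  choose T hT using step
  let Φ : ℕ → {φ : Ω → ℝ // Measurable φ ∧ ∀ ω, |φ ω| ≤ C} := fun n => T^[n] ⟨f, hfm, hf⟩
  let F : ℕ → Ω → ℝ := fun n => (Φ n).1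
  have hFm : ∀ n, Measurable (F n) := fun n => (Φ n).2.1
  have hF : ∀ n ω, |F n ω| ≤ C := fun n => (Φ n).2.2
  have hFT : ∀ γ j, altCondExp G1 G2 (P γ) (F j) =ᵐ[P γ] F (j + 1) := by
    intro γ j
    have h3 : F (j + 1) = (T (Φ j)).1 := by
      simp only [F, Φ, Function.iterate_succ_apply']
    rw [h3]
    exact hT (Φ j) γ
  have hum := measurable_limTailSup (measurable_cesaro hFm)
  have hub := abs_limTailSup_le (abs_cesaro_le hF)
  have hinv : ∀ γ, _ := fun γ =>
    ae_eq_of_condExp_eq_of_condExp_eq h1.1 h2.1 hum.aestronglyMeasurable hub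
      (altCondExp_limTailSup_cesaro h1.1 h2.1 hFm hF (hFT γ))
  obtain ⟨g, hgm, hg, hgc⟩ := h1.exists_bounded_condExp hP hum hub
  obtain ⟨k, hkm, hk, hkc⟩ := h2.exists_bounded_condExp hP hum hub
  have hku : ∀ γ, k =ᵐ[P γ] limTailSup (cesaro F) := fun γ => (hkc γ).symm.trans (hinv γ).2
  have hgk : ∀ γ, g =ᵐ[P γ] k := fun γ =>
    ((hgc γ).symm.trans (hinv γ).1).trans (hku γ).symm
  have hkm0 : Measurable k := hkm.mono h2.1 le_rfl
  have hkm1 : Measurable[G1] k := measurable_of_ae_eq_of_null_le h1.1 hN hgm hkm0 hgk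
  refine ⟨k, fun t ht => MeasurableSpace.measurableSet_inf.2 ⟨hkm1 ht, hkm ht⟩, fun γ =>
    Integrable.of_bound hkm0.aestronglyMeasurable C (Filter.Eventually.of_forall hk),
    fun γ s hs => ?_⟩
  obtain ⟨hs1, hs2⟩ := MeasurableSpace.measurableSet_inf.1 hs
  rw [integral_congr_ae (ae_restrict_of_ae (hku γ)),
    setIntegral_limTailSup_cesaro h1.1 h2.1 hFm hF (hFT γ) hs1 hs2]
  rfl

/-- If `G₁` and `G₂` are sufficient sub-σ-fields and the σ-field `N` generated by the
common `P γ`-null sets is contained in `G₁` or in `G₂`, then `G₁ ∩ G₂` is sufficient. -/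
theorem inter_isSufficient
    {Ω Γ : Type*} (m0 : MeasurableSpace Ω) (P : Γ → @Measure Ω m0)
    (hP : ∀ γ, IsProbabilityMeasure (P γ))
    (G1 G2 : MeasurableSpace Ω)
    (h1 : IsSufficient m0 P G1) (h2 : IsSufficient m0 P G2)
    (hN : MeasurableSpace.generateFrom
          {s : Set Ω | MeasurableSet[m0] s ∧ ∀ γ, P γ s = 0} ≤ G1 ∨
        MeasurableSpace.generateFrom
          {s : Set Ω | MeasurableSet[m0] s ∧ ∀ γ, P γ s = 0} ≤ G2) :
    IsSufficient m0 P (G1 ⊓ G2) := by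
  rcases hN with hN | hN
  · exact IsSufficient.inf_of_null_le_left hP h1 h2 hN
  · rw [inf_comm]
    exact IsSufficient.inf_of_null_le_left hP h2 h1 hN
end

section
/- Let $(\Omega, \mathcal{F})$ be a measurable space with a family of probability measures $\{\mathbb{P}_\gamma\}_{\gamma \in \Gamma}$, and let $\{\mathcal{G}_n\}_{n\ge 1}$ be a decreasing sequence of sufficient sub-$\sigma$-fields of $\mathcal{F}$ (i.e. $\mathcal{G}_n \supseteq \mathcal{G}_{n+1}$ for all $n \ge 1$, and each $\mathcal{G}_n$ is sufficient). Then $\bigcap_{n=1}^{\infty} \mathcal{G}_n$ is a sufficient sub-$\sigma$-field of $\mathcal{F}$. -/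
open MeasureTheory

open Filter Topology ProbabilityTheory

/-- Orthogonality of the increments of a sequence of conditional expectations. -/
lemma integral_sq_condExp_sub {Ω : Type*} {m₁ m₂ m0 : MeasurableSpace Ω} {μ : Measure Ω}
    [IsFiniteMeasure μ] (h₁₂ : m₁ ≤ m₂) (h₂ : m₂ ≤ m0) {f : Ω → ℝ} (hf : MemLp f 2 μ) :
    ∫ ω, ((μ[f|m₂]) ω - (μ[f|m₁]) ω) ^ 2 ∂μ =
      ∫ ω, (μ[f|m₂]) ω ^ 2 ∂μ - ∫ ω, (μ[f|m₁]) ω ^ 2 ∂μ := by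
  have h1 : MemLp (μ[f|m₁]) 2 μ := hf.condExp one_le_two
  have h2 : MemLp (μ[f|m₂]) 2 μ := hf.condExp one_le_two
  have hprod : Integrable (μ[f|m₁] * μ[f|m₂]) μ := h1.integrable_mul h2
  have hcross : ∫ ω, (μ[f|m₁] * μ[f|m₂]) ω ∂μ = ∫ ω, (μ[f|m₁]) ω ^ 2 ∂μ := by
    rw [← integral_condExp (h₁₂.trans h₂)]
    apply integral_congr_ae
    filter_upwards [condExp_mul_of_stronglyMeasurable_left stronglyMeasurable_condExp hprod
      integrable_condExp, condExp_condExp_of_le (μ := μ) (f := f) h₁₂ h₂] with ω hω hω'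
    rw [hω, Pi.mul_apply, hω', sq]
  have hsum : Integrable (fun ω => (μ[f|m₂]) ω ^ 2 + (μ[f|m₁]) ω ^ 2) μ :=
    h2.integrable_sq.add h1.integrable_sq
  have hexp : ∀ ω, ((μ[f|m₂]) ω - (μ[f|m₁]) ω) ^ 2 =
      ((μ[f|m₂]) ω ^ 2 + (μ[f|m₁]) ω ^ 2) - 2 * (μ[f|m₁] * μ[f|m₂]) ω := by
    intro ω
    simp only [Pi.mul_apply]
    ring
  simp_rw [hexp]
  rw [integral_sub hsum (hprod.const_mul 2),
    integral_add h2.integrable_sq h1.integrable_sq, integral_const_mul, hcross]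
  ring

/-- Conditional expectations of a square-integrable function along a decreasing sequence of
σ-fields are Cauchy in `L¹`. -/
lemma exists_integral_abs_condExp_sub_le {Ω : Type*} {m0 : MeasurableSpace Ω} {μ : Measure Ω}
    [IsProbabilityMeasure μ] {G : ℕ → MeasurableSpace Ω} (hG : Antitone G) (hle : ∀ n, G n ≤ m0)
    {f : Ω → ℝ} (hf : MemLp f 2 μ) {η : ℝ} (hη : 0 < η) :
    ∃ m, ∀ n, m ≤ n → ∫ ω, |(μ[f|G m]) ω - (μ[f|G n]) ω| ∂μ ≤ η := by
  have hmem : ∀ n, MemLp (μ[f|G n]) 2 μ := fun n => hf.condExp one_le_two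
  have hdiff : ∀ m n, m ≤ n → ∫ ω, ((μ[f|G m]) ω - (μ[f|G n]) ω) ^ 2 ∂μ =
      ∫ ω, (μ[f|G m]) ω ^ 2 ∂μ - ∫ ω, (μ[f|G n]) ω ^ 2 ∂μ :=
    fun m n hmn => integral_sq_condExp_sub (hG hmn) (hle m) hf
  have hanti : Antitone fun n => ∫ ω, (μ[f|G n]) ω ^ 2 ∂μ := by
    intro m n hmn
    have : 0 ≤ ∫ ω, ((μ[f|G m]) ω - (μ[f|G n]) ω) ^ 2 ∂μ := integral_nonneg fun ω => sq_nonneg _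
    rw [hdiff m n hmn] at this
    exact sub_nonneg.1 this
  have hbdd : BddBelow (Set.range fun n => ∫ ω, (μ[f|G n]) ω ^ 2 ∂μ) :=
    ⟨0, by rintro _ ⟨n, rfl⟩; exact integral_nonneg fun ω => sq_nonneg _⟩
  obtain ⟨m, hm⟩ := ((tendsto_atTop_ciInf hanti hbdd).eventually_lt_const
    (lt_add_of_pos_right _ (by positivity : (0 : ℝ) < η ^ 2 / 4))).exists
  refine ⟨m, fun n hmn => ?_⟩
  have hsq : ∫ ω, ((μ[f|G m]) ω - (μ[f|G n]) ω) ^ 2 ∂μ ≤ η ^ 2 / 4 := by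
    rw [hdiff m n hmn]
    have := ciInf_le hbdd n
    linarith
  have hint : Integrable (fun ω => ((μ[f|G m]) ω - (μ[f|G n]) ω) ^ 2) μ :=
    ((hmem m).sub (hmem n)).integrable_sq
  calc ∫ ω, |(μ[f|G m]) ω - (μ[f|G n]) ω| ∂μ
      ≤ ∫ ω, (η / 2 + 2 / η * ((μ[f|G m]) ω - (μ[f|G n]) ω) ^ 2) ∂μ := by
        refine integral_mono ((integrable_condExp.sub integrable_condExp).abs)
          ((integrable_const _).add (hint.const_mul _)) fun ω => ?_
        dsimp only
        rw [← sq_abs ((μ[f|G m]) ω - (μ[f|G n]) ω)]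
        generalize |(μ[f|G m]) ω - (μ[f|G n]) ω| = y
        have : η / 2 + 2 / η * y ^ 2 - y = ((η - y) ^ 2 + 3 * y ^ 2) / (2 * η) := by
          field_simp
          ring
        have : 0 ≤ ((η - y) ^ 2 + 3 * y ^ 2) / (2 * η) := by positivity
        linarith
    _ = η / 2 + 2 / η * ∫ ω, ((μ[f|G m]) ω - (μ[f|G n]) ω) ^ 2 ∂μ := by
        rw [integral_add (integrable_const _) (hint.const_mul _), integral_const_mul]
        simp
    _ ≤ η / 2 + 2 / η * (η ^ 2 / 4) := by gcongr
    _ = η := by field_simp; ring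

/-- Maximal inequality for conditional expectations along a decreasing sequence of σ-fields. -/
lemma mul_measure_exists_condExp_sub_le {Ω : Type*} {m0 : MeasurableSpace Ω} {μ : Measure Ω}
    [IsFiniteMeasure μ] {G : ℕ → MeasurableSpace Ω} (hG : Antitone G) (hle : ∀ n, G n ≤ m0)
    (f : Ω → ℝ) (ε : NNReal) (m N : ℕ) :
    ε * μ {ω | ∃ k ≤ N, (ε : ℝ) ≤ |(μ[f|G (m + k)]) ω - (μ[f|G (m + N)]) ω|} ≤
      ENNReal.ofReal (∫ ω, |(μ[f|G m]) ω - (μ[f|G (m + N)]) ω| ∂μ) := by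
  let F : Filtration ℕ m0 :=
    { seq := fun k => G (m + (N - k))
      mono' := fun i j hij => hG (by omega)
      le' := fun k => hle _ }
  have hmart : Martingale (fun k => μ[f|F k] - μ[f|G (m + N)]) F μ :=
    (martingale_condExp f F μ).sub
      (g := fun _ => μ[f|G (m + N)])
      ⟨fun k => stronglyMeasurable_condExp.mono (hG (by omega)), fun i j _ =>
        (condExp_of_stronglyMeasurable (F.le i)
          (stronglyMeasurable_condExp.mono (hG (by omega))) integrable_condExp).eventuallyEq⟩
  have hsub := hmart.submartingale.sup hmart.neg.submartingale
  have hmax := maximal_ineq hsub (fun k ω => abs_nonneg _) (ε := ε) N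
  refine (mul_le_mul_right (measure_mono ?_) _).trans (hmax.trans (ENNReal.ofReal_le_ofReal ?_))
  · rintro ω ⟨k, hk, hω⟩
    rw [Set.mem_ofPred_eq, Finset.le_sup'_iff]
    refine ⟨N - k, by simp, ?_⟩
    have hFk : F (N - k) = G (m + k) := congrArg (fun j => G (m + j)) (by omega)
    change (ε : ℝ) ≤ |(μ[f|F (N - k)]) ω - (μ[f|G (m + N)]) ω|
    rwa [hFk]
  · have hFN : F N = G m := congrArg G (by omega)
    change ∫ ω in _, |(μ[f|F N]) ω - (μ[f|G (m + N)]) ω| ∂μ ≤ _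
    rw [hFN]
    exact setIntegral_le_integral (integrable_condExp.sub integrable_condExp).abs
      (Eventually.of_forall fun ω => abs_nonneg _)

/-- Almost sure convergence of conditional expectations of a square-integrable function along a
decreasing sequence of σ-fields (reverse martingale convergence). -/
theorem ae_exists_tendsto_condExp_of_antitone {Ω : Type*} {m0 : MeasurableSpace Ω} {μ : Measure Ω}
    [IsProbabilityMeasure μ] {G : ℕ → MeasurableSpace Ω} (hG : Antitone G) (hle : ∀ n, G n ≤ m0)
    {f : Ω → ℝ} (hf : MemLp f 2 μ) :
    ∀ᵐ ω ∂μ, ∃ l, Tendsto (fun n => (μ[f|G n]) ω) atTop (𝓝 l) := by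
  have hnull : ∀ ε : NNReal, 0 < ε →
      μ {ω | ∀ m, ∃ n ≥ m, 2 * (ε : ℝ) ≤ |(μ[f|G n]) ω - (μ[f|G m]) ω|} = 0 := by
    intro ε hε
    have hsmall : ∀ η : NNReal, 0 < η →
        ε * μ {ω | ∀ m, ∃ n ≥ m, 2 * (ε : ℝ) ≤ |(μ[f|G n]) ω - (μ[f|G m]) ω|} ≤ η := by
      intro η hη
      obtain ⟨m, hm⟩ := exists_integral_abs_condExp_sub_le hG hle hf (NNReal.coe_pos.2 hη)
      let B : ℕ → Set Ω :=
        fun N => {ω | ∃ k ≤ N, 2 * (ε : ℝ) ≤ |(μ[f|G (m + k)]) ω - (μ[f|G m]) ω|}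
      have hBmono : Monotone B := fun N N' hN ω ⟨k, hk, hω⟩ => ⟨k, hk.trans hN, hω⟩
      have hB : ∀ N, ε * μ (B N) ≤ η := by
        intro N
        refine (mul_le_mul_right (measure_mono ?_) _).trans
          ((mul_measure_exists_condExp_sub_le hG hle f ε m N).trans ?_)
        · rintro ω ⟨k, hk, hω⟩
          by_contra hcon
          simp only [Set.mem_ofPred_eq, not_exists, not_and, not_le] at hcon
          have h1 := hcon k hk
          have h2 := hcon 0 (Nat.zero_le _)
          rw [add_zero] at h2
          have := abs_sub_le ((μ[f|G (m + k)]) ω) ((μ[f|G (m + N)]) ω) ((μ[f|G m]) ω)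
          rw [abs_sub_comm ((μ[f|G (m + N)]) ω)] at this
          linarith
        · rw [← ENNReal.ofReal_coe_nnreal]
          exact ENNReal.ofReal_le_ofReal (hm _ (Nat.le_add_right _ _))
      calc ε * μ {ω | ∀ m, ∃ n ≥ m, 2 * (ε : ℝ) ≤ |(μ[f|G n]) ω - (μ[f|G m]) ω|}
          ≤ ε * μ (⋃ N, B N) := by
            refine mul_le_mul_right (measure_mono fun ω hω => ?_) _
            obtain ⟨n, hn, hω⟩ := hω m
            refine Set.mem_iUnion.2 ⟨n - m, n - m, le_rfl, ?_⟩
            rwa [Nat.add_sub_cancel' hn]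
        _ = ⨆ N, ε * μ (B N) := by rw [hBmono.measure_iUnion, ENNReal.mul_iSup]
        _ ≤ η := iSup_le hB
    have hzero : ε * μ {ω | ∀ m, ∃ n ≥ m, 2 * (ε : ℝ) ≤ |(μ[f|G n]) ω - (μ[f|G m]) ω|} = 0 := by
      refine le_antisymm (ENNReal.le_of_forall_pos_le_add fun η hη _ => ?_) zero_le
      rw [zero_add]
      exact hsmall η hη
    exact (mul_eq_zero.1 hzero).resolve_left (by simpa using hε.ne')
  have hall : ∀ᵐ ω ∂μ, ∀ j : ℕ,
      ¬ ∀ m, ∃ n ≥ m, 2 * ((1 / ((j : NNReal) + 1) : NNReal) : ℝ) ≤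
        |(μ[f|G n]) ω - (μ[f|G m]) ω| := by
    refine ae_all_iff.2 fun j => ?_
    rw [ae_iff]
    simpa only [not_not] using hnull (1 / ((j : NNReal) + 1)) (by positivity)
  filter_upwards [hall] with ω hω
  refine cauchySeq_tendsto_of_complete (Metric.cauchySeq_iff'.2 fun ε hε => ?_)
  obtain ⟨j, hj⟩ := exists_nat_one_div_lt (half_pos hε)
  obtain ⟨m, hm⟩ := not_forall.1 (hω j)
  refine ⟨m, fun n hn => ?_⟩
  by_contra hcon
  rw [not_lt, Real.dist_eq] at hcon
  refine hm ⟨n, hn, le_trans ?_ hcon⟩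
  push_cast
  linarith

/-- The limit superior of a sequence adapted to a decreasing sequence of σ-fields is measurable
with respect to their intersection. -/
lemma measurable_iInf_limsup_of_antitone {Ω : Type*} {G : ℕ → MeasurableSpace Ω} (hG : Antitone G)
    {g : ℕ → Ω → ℝ} (hg : ∀ n, Measurable[G n] (g n)) :
    Measurable[⨅ n, G n] fun ω => limsup (fun n => g n ω) atTop := by
  intro s hs
  refine MeasurableSpace.measurableSet_iInf.2 fun k => ?_
  have hk : Measurable[G k] fun ω => limsup (fun n => g (n + k) ω) atTop :=
    Measurable.limsup (mδ := G k)
      fun n => (hg (n + k)).mono (hG (Nat.le_add_left _ _)) le_rfl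
  have heq : (fun ω => limsup (fun n => g n ω) atTop) =
      fun ω => limsup (fun n => g (n + k) ω) atTop :=
    funext fun ω => (limsup_nat_add (fun n => g n ω) k).symm
  rw [heq]
  exact hk hs

/-- For a bounded function, a common version of the conditional expectations given a sufficient
σ-field may be chosen with the same bound. -/
lemma IsSufficient.exists_bounded_version {Ω Γ : Type*} {m0 : MeasurableSpace Ω}
    {P : Γ → @Measure Ω m0} (hP : ∀ γ, IsProbabilityMeasure (P γ)) {G : MeasurableSpace Ω}
    (hG : IsSufficient m0 P G) {f : Ω → ℝ} (hf : Measurable[m0] f) {C : ℝ} (hC : 0 ≤ C)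
    (hfC : ∀ ω, |f ω| ≤ C) :
    ∃ g : Ω → ℝ, Measurable[G] g ∧ (∀ ω, |g ω| ≤ C) ∧ ∀ γ, g =ᵐ[P γ] (P γ)[f|G] := by
  obtain ⟨g, hg, hgi, hgs⟩ := hG.2 f hf ⟨C, hfC⟩
  refine ⟨fun ω => max (-C) (min C (g ω)), measurable_const.max (measurable_const.min hg),
    fun ω => abs_le.2 ⟨le_max_left _ _, max_le (by linarith) (min_le_left _ _)⟩, fun γ => ?_⟩
  have := hP γ
  have hfi : Integrable f (P γ) :=
    .of_bound hf.aestronglyMeasurable C (Eventually.of_forall hfC)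
  have hgc : g =ᵐ[P γ] (P γ)[f|G] :=
    ae_eq_condExp_of_forall_setIntegral_eq hG.1 hfi (fun s _ _ => (hgi γ).integrableOn)
      (fun s hs _ => (hgs γ s hs).symm) hg.stronglyMeasurable.aestronglyMeasurable
  have hbdd : ∀ᵐ ω ∂(P γ), |((P γ)[f|G]) ω| ≤ C :=
    ae_bdd_abs_condExp_of_ae_bdd_abs (Eventually.of_forall hfC)
  filter_upwards [hgc, hbdd] with ω hω hb
  rw [← hω] at hb ⊢
  rw [min_eq_right (abs_le.1 hb).2, max_eq_right (abs_le.1 hb).1]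

/-- A decreasing sequence of sufficient sub-σ-fields has sufficient intersection. -/
theorem iInf_isSufficient_of_antitone
    {Ω Γ : Type*} (m0 : MeasurableSpace Ω) (P : Γ → @Measure Ω m0)
    (hP : ∀ γ, IsProbabilityMeasure (P γ))
    (G : ℕ → MeasurableSpace Ω)
    (hdec : ∀ n, G (n + 1) ≤ G n)
    (hsuff : ∀ n, IsSufficient m0 P (G n)) :
    IsSufficient m0 P (⨅ n, G n) := by
  have hG : Antitone G := antitone_nat_of_succ_le hdec
  have hle : ∀ n, G n ≤ m0 := fun n => (hsuff n).1
  have hinf : ⨅ n, G n ≤ m0 := (iInf_le G 0).trans (hle 0)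
  refine ⟨hinf, ?_⟩
  rintro f hf ⟨C', hC'⟩
  obtain ⟨C, hC, hfC⟩ : ∃ C : ℝ, 0 ≤ C ∧ ∀ ω, |f ω| ≤ C :=
    ⟨max C' 0, le_max_right _ _, fun ω => (hC' ω).trans (le_max_left _ _)⟩
  choose g hgm hgC hgP using fun n => (hsuff n).exists_bounded_version hP hf hC hfC
  have hgm0 : ∀ n, Measurable[m0] (g n) := fun n => (hgm n).mono (hle n) le_rfl
  have hlim : ∀ γ, ∀ᵐ ω ∂(P γ),
      Tendsto (fun n => g n ω) atTop (𝓝 (limsup (fun n => g n ω) atTop)) := by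
    intro γ
    have := hP γ
    have hf2 : MemLp f 2 (P γ) :=
      .of_bound hf.aestronglyMeasurable C (Eventually.of_forall hfC)
    filter_upwards [ae_exists_tendsto_condExp_of_antitone hG hle hf2,
      ae_all_iff.2 fun n => hgP n γ] with ω ⟨l, hl⟩ hω
    simp_rw [← hω] at hl
    rwa [hl.limsup_eq]
  have hmeas := measurable_iInf_limsup_of_antitone hG hgm
  refine ⟨_, hmeas, fun γ => ?_, fun γ s hs => ?_⟩
  · have := hP γ
    refine .of_bound (hmeas.mono hinf le_rfl).aestronglyMeasurable C ?_
    filter_upwards [hlim γ] with ω hω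
    exact le_of_tendsto hω.norm (Eventually.of_forall fun n => hgC n ω)
  · have := hP γ
    have hfi : Integrable f (P γ) :=
      .of_bound hf.aestronglyMeasurable C (Eventually.of_forall hfC)
    have hconv := tendsto_integral_of_dominated_convergence (μ := (P γ).restrict s) (fun _ => C)
      (fun n => (hgm0 n).aestronglyMeasurable) (integrable_const C)
      (fun n => Eventually.of_forall (hgC n)) (ae_restrict_of_ae (hlim γ))
    refine tendsto_nhds_unique (tendsto_const_nhds.congr fun n => ?_) hconv
    rw [integral_congr_ae (ae_restrict_of_ae (hgP n γ)),
      setIntegral_condExp (hle n) hfi (MeasurableSpace.measurableSet_iInf.1 hs n)]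
end
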